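/- Every countable untranscendable linear order that does not have exactly two elements is strongly indecomposable: if X is countable, untranscendable, and not a two-element order, then for every subset S ⊆ X, X embeds in S or X embeds in X \ S. -/

import Mathlib

universe u

/-- `Embeds X Y` means there is a strictly order-preserving map from `X` to `Y`. -/
def Embeds (X : Type u) (Y : Type v) [LinearOrder X] [LinearOrder Y] : Prop :=
  ∃ f : X → Y, StrictMono f

universe v w


inductive Tm : Type
  | leaf : Tm
  | node : Bool → (ℕ → Tm) → Tm

namespace Tm

def Ch (a b : Tm) : Prop := ∃ e f n, b = node e f ∧ a = f n

theorem ch_wf : WellFounded Ch := by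
  constructor
  intro b
  induction b with
  | leaf => constructor; rintro a ⟨e, f, n, h, _⟩; cases h
  | node e f ih => constructor; rintro a ⟨e', f', n, h, rfl⟩; cases h; exact ih n

def Desc : Tm → Tm → Prop := Relation.TransGen Ch

theorem desc_wf : WellFounded Desc := ch_wf.transGen

def slt : Tm × Bool → Tm × Bool → Prop := Prod.Lex Desc (fun x y => x = false ∧ y = true)

theorem bool_wf : WellFounded (fun x y : Bool => x = false ∧ y = true) := by
  have h0 : Acc (fun x y : Bool => x = false ∧ y = true) false := by
    constructor; rintro y ⟨_, h⟩; cases h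
  constructor
  intro a
  cases a
  · exact h0
  · constructor; rintro y ⟨rfl, _⟩; exact h0

theorem slt_wf : WellFounded slt := WellFounded.prod_lex desc_wf bool_wf

def sle (a b : Tm × Bool) : Prop := a = b ∨ slt a b

theorem slt_trans {a b c} (h1 : slt a b) (h2 : slt b c) : slt a c := by
  obtain ⟨a1, a2⟩ := a
  obtain ⟨b1, b2⟩ := b
  obtain ⟨c1, c2⟩ := c
  simp only [slt, Prod.lex_def] at *
  rcases h1 with h1 | ⟨h1, h1'⟩
  · rcases h2 with h2 | ⟨h2, h2'⟩
    · exact Or.inl (h1.trans h2)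
    · subst h2; exact Or.inl h1
  · subst h1
    rcases h2 with h2 | ⟨h2, h2'⟩
    · exact Or.inl h2
    · right; refine ⟨h2, h1'.1, h2'.2⟩

theorem sle_refl (a) : sle a a := Or.inl rfl

theorem sle_trans {a b c} (h1 : sle a b) (h2 : sle b c) : sle a c := by
  rcases h1 with rfl | h1
  · exact h2
  · rcases h2 with rfl | h2
    · exact Or.inr h1
    · exact Or.inr (slt_trans h1 h2)

theorem sle_antisymm {a b} (h1 : sle a b) (h2 : sle b a) : a = b := by
  rcases h1 with rfl | h1
  · rfl
  · rcases h2 with rfl | h2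
    · rfl
    · exact absurd (slt_trans h1 h2) (slt_wf.irrefl.irrefl a)

theorem sle_fst {a b : Tm × Bool} (h : sle a b) : a.1 = b.1 ∨ Desc a.1 b.1 := by
  rcases h with rfl | h
  · exact Or.inl rfl
  · simp only [slt, Prod.lex_def] at h
    rcases h with h | h
    · exact Or.inr h
    · exact Or.inl h.1

/-- the part of `A` below `N` -/
noncomputable def res (A : Set ℕ) (N : ℕ) : Finset ℕ := by
  classical exact (Finset.range N).filter (· ∈ A)

theorem mem_res {A : Set ℕ} {N x : ℕ} : x ∈ res A N ↔ x < N ∧ x ∈ A := by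
  classical
  simp [res]

/-- remove the least element -/
noncomputable def tl (A : Set ℕ) : Set ℕ := {x | x ∈ A ∧ ∃ y ∈ A, y < x}
def ftl (s : Finset ℕ) : Finset ℕ := s.filter (fun x => ∃ y ∈ s, y < x)

theorem mem_ftl {s : Finset ℕ} {x : ℕ} : x ∈ ftl s ↔ x ∈ s ∧ ∃ y ∈ s, y < x := by
  simp [ftl]

theorem res_tl (A : Set ℕ) (N : ℕ) : res (tl A) N = ftl (res A N) := by
  ext x
  simp only [mem_res, mem_ftl, tl, Set.mem_ofPred_eq]
  constructor
  · rintro ⟨h1, h2, y, hy, hyx⟩; exact ⟨⟨h1, h2⟩, y, ⟨by omega, hy⟩, hyx⟩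
  · rintro ⟨⟨h1, h2⟩, y, ⟨_, hy⟩, hyx⟩; exact ⟨h1, h2, y, hy, hyx⟩

theorem tl_sub (A : Set ℕ) : tl A ⊆ A := fun _ h => h.1

theorem tl_inf {A : Set ℕ} (h : A.Infinite) : (tl A).Infinite := by
  obtain ⟨m, hm⟩ := h.nonempty
  have : A \ Set.Iic m ⊆ tl A := by
    rintro x ⟨hx, hx'⟩
    exact ⟨hx, m, hm, by simpa using hx'⟩
  exact (h.sdiff (Set.finite_Iic m)).mono this

structure Bad (le : Tm → Tm → Prop) (p : Finset ℕ → Tm × Bool) (X : Set ℕ) : Prop where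
  inf : X.Infinite
  mono : ∀ A ⊆ X, ∀ M N, M ≤ N → sle (p (res A N)) (p (res A M))
  absorb : ∀ A ⊆ X, ∀ M N, M ≤ N → (p (res A M)).2 = true → p (res A N) = p (res A M)
  total : ∀ A ⊆ X, A.Infinite → ∃ N, (p (res A N)).2 = true
  bad : ∀ A ⊆ X, A.Infinite → ∀ N, (p (res A N)).2 = true → (p (res (tl A) N)).2 = true →
    ¬ le (p (res A N)).1 (p (res (tl A) N)).1
  smooth : ∀ s : Finset ℕ, ↑s ⊆ X → (p (ftl s)).2 = true → (p s).2 = true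
  emp : (p ∅).2 = false

def Red (q p : Finset ℕ → Tm × Bool) : Prop :=
  ∀ s, sle (q s) (p s) ∧ ((q s).2 = true → (p s).2 = true)

theorem Red.refl (p) : Red p p := fun _ => ⟨sle_refl _, id⟩
theorem Red.trans {p q r} (h1 : Red p q) (h2 : Red q r) : Red p r :=
  fun s => ⟨sle_trans (h1 s).1 (h2 s).1, fun h => (h2 s).2 ((h1 s).2 h)⟩

variable {le : Tm → Tm → Prop}

/-- `t` cannot be lowered, keeping the part below `N` -/
def Fix (le : Tm → Tm → Prop) (N : ℕ) (t : Finset ℕ) (p : Finset ℕ → Tm × Bool) (X : Set ℕ) : Prop :=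
  ∀ r Z, Bad le r Z → Z ⊆ X → res Z N = res X N → Red r p → r t = p t

theorem stage1 {p X} (hp : Bad le p X) (N : ℕ) (t : Finset ℕ) :
    ∃ q Y, Bad le q Y ∧ Y ⊆ X ∧ res Y N = res X N ∧ Red q p ∧ Fix le N t q Y := by
  let S : Set (Tm × Bool) :=
    {v | ∃ q Y, Bad le q Y ∧ Y ⊆ X ∧ res Y N = res X N ∧ Red q p ∧ q t = v}
  have hS : S.Nonempty := ⟨p t, p, X, hp, subset_rfl, rfl, Red.refl p, rfl⟩
  obtain ⟨v, ⟨q, Y, h1, h2, h3, h4, h5⟩, hmin⟩ := slt_wf.has_min S hS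
  refine ⟨q, Y, h1, h2, h3, h4, ?_⟩
  intro r Z hr hZ hZN hrq
  rcases (hrq t).1 with h | h
  · exact h
  · exact absurd (h5 ▸ h) (hmin _ ⟨r, Z, hr, hZ.trans h2, hZN.trans h3, hrq.trans h4, rfl⟩)

theorem Fix.of_red {p X q Y N t} (h : Fix le N t p X) (hq : Bad le q Y) (h1 : Y ⊆ X)
    (h2 : res Y N = res X N) (h3 : Red q p) : Fix le N t q Y := by
  intro r Z hr hZ hZN hrq
  rw [h r Z hr (hZ.trans h1) (hZN.trans h2) (hrq.trans h3), h q Y hq h1 h2 h3]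

theorem stage {p X} (hp : Bad le p X) (N : ℕ) (L : Finset (Finset ℕ)) :
    ∃ q Y, Bad le q Y ∧ Y ⊆ X ∧ res Y N = res X N ∧ Red q p ∧ ∀ t ∈ L, Fix le N t q Y := by
  classical
  induction L using Finset.induction_on with
  | empty => exact ⟨p, X, hp, subset_rfl, rfl, Red.refl p, by simp⟩
  | insert t L _ ih =>
    obtain ⟨q, Y, h1, h2, h3, h4, h5⟩ := ih
    obtain ⟨q', Y', g1, g2, g3, g4, g5⟩ := stage1 h1 N t
    refine ⟨q', Y', g1, g2.trans h2, g3.trans h3, g4.trans h4, ?_⟩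
    intro s hs
    rcases Finset.mem_insert.1 hs with rfl | hs
    · exact g5
    · exact (h5 s hs).of_red g1 g2 g3 g4

structure St (le : Tm → Tm → Prop) where
  p : Finset ℕ → Tm × Bool
  X : Set ℕ
  N : ℕ
  bad : Bad le p X

theorem step (σ : St le) : ∃ σ' : St le, ∃ x, x ∈ σ.X ∧ σ.N ≤ x ∧ (∀ y ∈ σ.X, σ.N ≤ y → x ≤ y) ∧
    σ'.N = x + 1 ∧ σ'.X ⊆ σ.X ∧ res σ'.X (x+1) = res σ.X (x+1) ∧ Red σ'.p σ.p ∧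
    ∀ t ⊆ Finset.range (x+1), Fix le (x+1) t σ'.p σ'.X := by
  have hex : ∃ x, x ∈ σ.X ∧ σ.N ≤ x := by
    obtain ⟨x, hx, h⟩ := σ.bad.inf.exists_gt σ.N
    exact ⟨x, hx, h.le⟩
  classical
  have hx := Nat.find_spec hex
  obtain ⟨q, Y, h1, h2, h3, h4, h5⟩ :=
    stage σ.bad (Nat.find hex + 1) (Finset.range (Nat.find hex + 1)).powerset
  refine ⟨⟨q, Y, Nat.find hex + 1, h1⟩, Nat.find hex, hx.1, hx.2,
    fun y hy hy' => Nat.find_min' hex ⟨hy, hy'⟩, rfl, h2, h3, h4, ?_⟩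
  intro t ht
  exact h5 t (Finset.mem_powerset.2 ht)

theorem res_sub {A B : Set ℕ} {M N : ℕ} (h : M ≤ N) (hr : res A N = res B N) : res A M = res B M := by
  ext x
  have := Finset.ext_iff.1 hr x
  simp only [mem_res] at *
  constructor
  · rintro ⟨h1, h2⟩; exact ⟨h1, (this.1 ⟨by omega, h2⟩).2⟩
  · rintro ⟨h1, h2⟩; exact ⟨h1, (this.2 ⟨by omega, h2⟩).2⟩

theorem fusion {p₀ X₀} (h0 : Bad le p₀ X₀) : ∃ p X, Bad le p X ∧
    ∀ t : Finset ℕ, ↑t ⊆ X → ∀ x ∈ t, (∀ y ∈ t, y ≤ x) → Fix le (x+1) t p X := by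
  classical
  choose nx xx hxX hxN hxmin hnN hnX hnres hnred hnfix using (step (le := le))
  let σ : ℕ → St le := fun n => Nat.rec ⟨p₀, X₀, 0, h0⟩ (fun _ s => nx s) n
  have hσ : ∀ n, σ (n+1) = nx (σ n) := fun n => rfl
  let x : ℕ → ℕ := fun n => xx (σ n)
  have hN : ∀ n, (σ (n+1)).N = x n + 1 := fun n => hnN _
  have hXanti : ∀ m n, m ≤ n → (σ n).X ⊆ (σ m).X := by
    intro m n hmn
    induction hmn with
    | refl => exact subset_rfl
    | step _ ih => exact (hnX _).trans ih
  have hred : ∀ m n, m ≤ n → Red (σ n).p (σ m).p := by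
    intro m n hmn
    induction hmn with
    | refl => exact Red.refl _
    | step _ ih => exact (hnred _).trans ih
  have hxlt : StrictMono x := by
    apply strictMono_nat_of_lt_succ
    intro n
    have := hxN (σ (n+1))
    rw [hN] at this
    exact this
  have hres : ∀ m n, m < n → res (σ n).X (x m + 1) = res (σ (m+1)).X (x m + 1) := by
    intro m n hmn
    induction hmn with
    | refl => rfl
    | step h ih =>
      rename_i k
      rw [← ih]
      exact res_sub (by have h' : xx (σ m) < xx (σ k) := hxlt h
                        show xx (σ m) + 1 ≤ xx (σ k) + 1
                        omega) (hnres (σ k))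
  -- the limit set
  let X : Set ℕ := {y | ∀ n, y ∈ (σ n).X}
  have hxmem : ∀ n, x n ∈ X := by
    intro n k
    rcases le_or_gt k n with h | h
    · exact hXanti _ _ h (hxX (σ n))
    · have h1 : x n ∈ res (σ (n+1)).X (x n + 1) := by
        rw [hσ, hnres (σ n), mem_res]; exact ⟨by simp [x], hxX _⟩
      rw [← hres n k h, mem_res] at h1
      exact h1.2
  have hXx : ∀ y ∈ X, ∃ n, y = x n := by
    intro y hy
    by_contra hcon
    push Not at hcon
    have : ∀ n, (σ n).N ≤ y := by
      intro n
      induction n with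
      | zero => exact Nat.zero_le _
      | succ n ih =>
        rw [hN]
        have h1 : x n ≤ y := hxmin (σ n) y (hy n) ih
        have := hcon n
        omega
    have h1 := this (y+1)
    rw [hN] at h1
    have := hxlt.id_le y
    simp at this
    omega
  have hXres : ∀ n, res X (x n + 1) = res (σ (n+1)).X (x n + 1) := by
    intro n
    ext y
    rw [mem_res, mem_res]
    constructor
    · rintro ⟨h1, h2⟩; exact ⟨h1, h2 (n+1)⟩
    · rintro ⟨h1, h2⟩
      refine ⟨h1, fun k => ?_⟩
      rcases le_or_gt k (n+1) with h | h
      · exact hXanti _ _ h h2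
      · have h3 : y ∈ res (σ (n+1)).X (x n + 1) := mem_res.2 ⟨h1, h2⟩
        rw [← hres n k (by omega)] at h3
        exact (mem_res.1 h3).2
  -- stabilisation
  have hstab : ∀ t : Finset ℕ, ∀ n, t ⊆ Finset.range (x n + 1) → ∀ k, n < k →
      (σ k).p t = (σ (n+1)).p t := by
    intro t n ht k hk
    exact hnfix (σ n) t ht _ _ (σ k).bad (hXanti _ _ hk) (hres n k hk) (hred _ _ hk)
  have hbd : ∀ t : Finset ℕ, ∃ n, t ⊆ Finset.range (x n + 1) := by
    intro t
    refine ⟨t.sup id, ?_⟩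
    intro y hy
    have h1 : y ≤ t.sup id := Finset.le_sup (f := id) hy
    rw [Finset.mem_range]
    have : t.sup id ≤ x (t.sup id) := hxlt.id_le (t.sup id)
    omega
  choose β hβ using hbd
  let p : Finset ℕ → Tm × Bool := fun t => (σ (β t + 1)).p t
  have hp : ∀ t k, β t < k → p t = (σ k).p t := fun t k hk => (hstab t _ (hβ t) k hk).symm
  have hpred : ∀ k, Red p (σ k).p := by
    intro k t
    rw [hp t (max k (β t + 1)) (by omega)]
    exact hred _ _ (le_max_left _ _) t
  have hXsub : ∀ n, X ⊆ (σ n).X := fun n y hy => hy n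
  have hmono : ∀ A ⊆ X, ∀ M N, M ≤ N → sle (p (res A N)) (p (res A M)) := by
    intro A hA M N hMN
    let k := max (β (res A N)) (β (res A M)) + 1
    rw [hp (res A N) k (by omega), hp (res A M) k (by omega)]
    exact (σ k).bad.mono A (hA.trans (hXsub k)) M N hMN
  have hbad : Bad le p X := by
    refine ⟨?_, hmono, ?_, ?_, ?_, ?_, ?_⟩
    · exact (Set.infinite_range_of_injective hxlt.injective).mono (by rintro _ ⟨n, rfl⟩; exact hxmem n)
    · intro A hA M N hMN
      let k := max (β (res A N)) (β (res A M)) + 1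
      rw [hp (res A N) k (by omega), hp (res A M) k (by omega)]
      exact (σ k).bad.absorb A (hA.trans (hXsub k)) M N hMN
    · intro A hA hAi
      obtain ⟨v, ⟨N0, hN0⟩, hmin⟩ := slt_wf.has_min (Set.range fun N => p (res A N)) ⟨_, 0, rfl⟩
      simp only at hN0
      let k := β (res A N0) + 1
      obtain ⟨N1, hN1⟩ := (σ k).bad.total A (hA.trans (hXsub k)) hAi
      let N := max N0 N1
      have hd : ((σ k).p (res A N)).2 = true := by
        rw [(σ k).bad.absorb A (hA.trans (hXsub k)) N1 N (le_max_right _ _) hN1]; exact hN1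
      have e1 : p (res A N) = p (res A N0) := by
        rcases hmono A hA N0 N (le_max_left _ _) with h | h
        · exact h
        · exact absurd (hN0 ▸ h) (hmin _ ⟨N, rfl⟩)
      have e2 : sle (p (res A N)) ((σ k).p (res A N)) := (hpred k _).1
      have e3 : sle ((σ k).p (res A N)) ((σ k).p (res A N0)) :=
        (σ k).bad.mono A (hA.trans (hXsub k)) _ _ (le_max_left _ _)
      have e4 : p (res A N0) = (σ k).p (res A N0) := hp (res A N0) k (by omega)
      rw [← e4, ← e1] at e3
      refine ⟨N, ?_⟩
      rw [sle_antisymm e2 e3]; exact hd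
    · intro A hA hAi N
      let k := max (β (res A N)) (β (res (tl A) N)) + 1
      rw [hp (res A N) k (by omega), hp (res (tl A) N) k (by omega)]
      exact (σ k).bad.bad A (hA.trans (hXsub k)) hAi N
    · intro s hs
      let k := max (β s) (β (ftl s)) + 1
      rw [hp s k (by omega), hp (ftl s) k (by omega)]
      exact (σ k).bad.smooth s (hs.trans (hXsub k))
    · exact (σ (β ∅ + 1)).bad.emp
  refine ⟨p, X, hbad, ?_⟩
  intro t htX y hy hymax r Z hr hZX hZres hrp
  obtain ⟨n, rfl⟩ := hXx y (htX hy)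
  have ht : t ⊆ Finset.range (x n + 1) := by
    intro z hz; rw [Finset.mem_range]; have := hymax z hz; omega
  have e1 := hnfix (σ n) t ht r Z hr (hZX.trans (hXsub (n+1)))
    (hZres.trans (hXres n)) (hrp.trans (hpred (n+1)))
  rw [e1, hp t (max (β t) n + 1) (by omega)]
  exact (hstab t n ht (max (β t) n + 1) (by omega)).symm

end Tm

namespace Tm
variable {le : Tm → Tm → Prop}

theorem desc_le (htr : ∀ a b c, le a b → le b c → le a c) (hch : ∀ b f n, le (f n) (node b f))
    {a b : Tm} (h : Desc a b) : le a b := by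
  have h1 : ∀ a b, Ch a b → le a b := by
    rintro a b ⟨e, f, n, rfl, rfl⟩; exact hch _ _ _
  induction h with
  | single h => exact h1 _ _ h
  | tail _ h ih => exact htr _ _ _ ih (h1 _ _ h)

theorem ftl_filter (s : Finset ℕ) (x : ℕ) : (ftl s).filter (· < x) = ftl (s.filter (· < x)) := by
  ext y
  simp only [Finset.mem_filter, mem_ftl]
  constructor
  · rintro ⟨⟨h1, z, h2, h3⟩, h4⟩; exact ⟨⟨h1, h4⟩, z, ⟨h2, by omega⟩, h3⟩
  · rintro ⟨⟨h1, h4⟩, z, ⟨h2, _⟩, h3⟩; exact ⟨⟨h1, z, h2, h3⟩, h4⟩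

theorem res_filter (A : Set ℕ) {x n : ℕ} (h : x ≤ n) : (res A n).filter (· < x) = res A x := by
  ext y
  simp only [Finset.mem_filter, mem_res]
  constructor
  · rintro ⟨⟨_, h2⟩, h3⟩; exact ⟨h3, h2⟩
  · rintro ⟨h2, h3⟩; exact ⟨⟨by omega, h3⟩, h2⟩

theorem res_coe_sub (A : Set ℕ) (n : ℕ) : ↑(res A n) ⊆ A := fun _ h => (mem_res.1 h).2

theorem res_zero (A : Set ℕ) : res A 0 = ∅ := by
  ext y; simp [mem_res]

theorem minimal (htr : ∀ a b c, le a b → le b c → le a c) (hch : ∀ b f n, le (f n) (node b f))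
    {p X} (hp : Bad le p X)
    (hfix : ∀ t : Finset ℕ, ↑t ⊆ X → ∀ x ∈ t, (∀ y ∈ t, y ≤ x) → Fix le (x+1) t p X)
    {g Y} (hg : Bad le g Y) (hYX : Y ⊆ X) (hgp : Red g p)
    (hne : ∀ s : Finset ℕ, ↑s ⊆ Y → (p s).2 = true → g s ≠ p s) : False := by
  classical
  have hex := hp.total Y hYX hg.inf
  have hN := Nat.find_spec hex
  have hNmin := fun m => Nat.find_min hex (m := m)
  obtain ⟨x, hx⟩ : ∃ x, Nat.find hex = x + 1 := by
    refine Nat.exists_eq_succ_of_ne_zero ?_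
    intro h0
    rw [h0, res_zero, hp.emp] at hN
    cases hN
  rw [hx] at hN hNmin
  have hund : (p (res Y x)).2 = false := by
    have := hNmin x (by omega)
    simpa using this
  have hxY : x ∈ Y := by
    by_contra hxY
    have : res Y (x+1) = res Y x := by
      ext y; simp only [mem_res]
      constructor
      · rintro ⟨h1, h2⟩
        refine ⟨?_, h2⟩
        have : y ≠ x := by rintro rfl; exact hxY h2
        omega
      · rintro ⟨h1, h2⟩; exact ⟨by omega, h2⟩
    rw [this, hund] at hN
    cases hN
  let R : Finset ℕ → Prop := fun s => ↑s ⊆ Y ∧ (∃ z ∈ s, x ≤ z) ∧ (p (s.filter (· < x))).2 = false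
  let Y' : Set ℕ := {y | (y ∈ X ∧ y ≤ x) ∨ (y ∈ Y ∧ x < y)}
  have hY'X : Y' ⊆ X := by
    rintro y (h | h)
    · exact h.1
    · exact hYX h.1
  let h : Finset ℕ → Tm × Bool := fun s => if R s then g s else p s
  have hR : ∀ s, R s → h s = g s := fun s hs => if_pos hs
  have hnR : ∀ s, ¬ R s → h s = p s := fun s hs => if_neg hs
  have hR1 : ∀ A ⊆ Y', ∀ n, R (res A n) → A ⊆ Y ∧ (p (res A x)).2 = false ∧ ∃ z ∈ A, x ≤ z ∧ z < n := by
    rintro A hA n ⟨h1, ⟨z, hz, hxz⟩, h3⟩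
    have hz' := mem_res.1 hz
    rw [res_filter A (by omega)] at h3
    refine ⟨?_, h3, z, hz'.2, hxz, hz'.1⟩
    intro y hy
    rcases hA hy with h | h
    · exact h1 (mem_res.2 ⟨by omega, hy⟩)
    · exact h.1
  have hR2 : ∀ A ⊆ Y, ∀ n, (p (res A x)).2 = false → (∃ z ∈ A, x ≤ z ∧ z < n) → R (res A n) := by
    rintro A hA n h1 ⟨z, hz, hxz, hzn⟩
    refine ⟨(res_coe_sub A n).trans hA, ⟨z, mem_res.2 ⟨hzn, hz⟩, hxz⟩, ?_⟩
    rw [res_filter A (by omega)]; exact h1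
  have hRpers : ∀ A ⊆ Y', ∀ M N, M ≤ N → R (res A M) → R (res A N) := by
    intro A hA M N hMN hM
    obtain ⟨h1, h2, z, hz, h3, h4⟩ := hR1 A hA M hM
    exact hR2 A h1 N h2 ⟨z, hz, h3, by omega⟩
  have hRemp : ¬ R ∅ := by rintro ⟨_, ⟨z, hz, _⟩, _⟩; simp at hz
  have hRftl : ∀ s, R s → R (ftl s) ∨ ftl s = ∅ := by
    rintro s ⟨h1, ⟨z, hz, hxz⟩, h3⟩
    by_cases hemp : ftl s = ∅
    · exact Or.inr hemp
    left
    refine ⟨?_, ?_, ?_⟩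
    · intro y hy; exact h1 (mem_ftl.1 hy).1
    · by_cases hz' : z ∈ ftl s
      · exact ⟨z, hz', hxz⟩
      · obtain ⟨w, hw⟩ := Finset.nonempty_iff_ne_empty.2 hemp
        refine ⟨w, hw, ?_⟩
        rw [mem_ftl] at hw hz'
        obtain ⟨hw, v, hv, hvw⟩ := hw
        push Not at hz'
        have := hz' hz v hv
        omega
    · rw [ftl_filter]
      by_contra hc
      have : (p (ftl (s.filter (· < x)))).2 = true := by simpa using hc
      have := hp.smooth (s.filter (· < x))
        (by intro y hy; exact hYX (h1 (Finset.mem_filter.1 hy).1)) this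
      rw [h3] at this
      cases this
  have hbad : Bad le h Y' := by
    refine ⟨?_, ?_, ?_, ?_, ?_, ?_, ?_⟩
    · refine (hg.inf.sdiff (Set.finite_Iic x)).mono ?_
      rintro y ⟨h1, h2⟩
      exact Or.inr ⟨h1, by simpa using h2⟩
    · intro A hA M N hMN
      by_cases hM : R (res A M)
      · have hN' := hRpers A hA M N hMN hM
        rw [hR _ hM, hR _ hN']
        exact hg.mono A (hR1 A hA M hM).1 M N hMN
      · rw [hnR _ hM]
        have h1 := hp.mono A (hA.trans hY'X) M N hMN
        by_cases hN' : R (res A N)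
        · rw [hR _ hN']
          exact sle_trans (hgp _).1 h1
        · rw [hnR _ hN']; exact h1
    · intro A hA M N hMN hd
      by_cases hM : R (res A M)
      · have hN' := hRpers A hA M N hMN hM
        rw [hR _ hM] at hd ⊢
        rw [hR _ hN']
        exact hg.absorb A (hR1 A hA M hM).1 M N hMN hd
      · rw [hnR _ hM] at hd ⊢
        by_cases hN' : R (res A N)
        · exfalso
          obtain ⟨h1, h2, z, hz, h3, h4⟩ := hR1 A hA N hN'
          rcases le_or_gt M x with hMx | hMx
          · have := hp.absorb A (hA.trans hY'X) M x hMx hd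
            rw [this, hd] at h2; cases h2
          · have : res A M = res A x := by
              ext y; simp only [mem_res]
              constructor
              · rintro ⟨h5, h6⟩
                refine ⟨?_, h6⟩
                by_contra hc
                exact hM (hR2 A h1 M h2 ⟨y, h6, by omega, h5⟩)
              · rintro ⟨h5, h6⟩; exact ⟨by omega, h6⟩
            rw [this, h2] at hd; cases hd
        · rw [hnR _ hN']
          exact hp.absorb A (hA.trans hY'X) M N hMN hd
    · intro A hA hAi
      by_cases hc : A ⊆ Y ∧ (p (res A x)).2 = false
      · obtain ⟨N1, hN1⟩ := hg.total A hc.1 hAi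
        obtain ⟨z, hz, hxz⟩ := hAi.exists_gt x
        refine ⟨max N1 (z+1), ?_⟩
        rw [hR _ (hR2 A hc.1 _ hc.2 ⟨z, hz, by omega, by omega⟩),
          hg.absorb A hc.1 N1 _ (by omega) hN1]
        exact hN1
      · obtain ⟨N1, hN1⟩ := hp.total A (hA.trans hY'X) hAi
        refine ⟨N1, ?_⟩
        rw [hnR _ (fun hr => hc ⟨(hR1 A hA _ hr).1, (hR1 A hA _ hr).2.1⟩)]
        exact hN1
    · intro A hA hAi N hd1 hd2
      have htl := (tl_sub A).trans hA
      by_cases hr : R (res A N)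
      · rcases hRftl _ hr with hr' | hr'
        · rw [← res_tl] at hr'
          rw [hR _ hr] at hd1 ⊢
          rw [hR _ hr'] at hd2 ⊢
          exact hg.bad A (hR1 A hA N hr).1 hAi N hd1 hd2
        · rw [res_tl, hr', hnR _ hRemp, hp.emp] at hd2
          cases hd2
      · rw [hnR _ hr] at hd1 ⊢
        by_cases hr' : R (res (tl A) N)
        · rw [hR _ hr'] at hd2 ⊢
          have h1 := hp.bad A (hA.trans hY'X) hAi N hd1 ((hgp _).2 hd2)
          intro hle
          apply h1
          rcases sle_fst (hgp (res (tl A) N)).1 with e | e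
          · rw [← e]; exact hle
          · exact htr _ _ _ hle (desc_le htr hch e)
        · rw [hnR _ hr'] at hd2 ⊢
          exact hp.bad A (hA.trans hY'X) hAi N hd1 hd2
    · intro s hs hd
      by_cases hr' : R (ftl s)
      · rw [hR _ hr'] at hd
        by_cases hr : R s
        · rw [hR _ hr]; exact hg.smooth s hr.1 hd
        · rw [hnR _ hr]; exact hp.smooth s (hs.trans hY'X) ((hgp _).2 hd)
      · rw [hnR _ hr'] at hd
        by_cases hr : R s
        · rcases hRftl _ hr with h1 | h1
          · exact absurd h1 hr'
          · rw [h1, hp.emp] at hd; cases hd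
        · rw [hnR _ hr]; exact hp.smooth s (hs.trans hY'X) hd
    · rw [hnR _ hRemp]; exact hp.emp
  have hred : Red h p := by
    intro s
    by_cases hr : R s
    · rw [hR _ hr]; exact hgp s
    · rw [hnR _ hr]; exact ⟨sle_refl _, id⟩
  have hRt : R (res Y (x+1)) := hR2 Y subset_rfl _ hund ⟨x, hxY, le_rfl, by omega⟩
  have key := hfix (res Y (x+1)) ((res_coe_sub _ _).trans hYX) x (mem_res.2 ⟨by omega, hxY⟩)
    (fun y hy => by have := (mem_res.1 hy).1; omega) h Y' hbad hY'X (by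
      ext y
      simp only [mem_res]
      constructor
      · rintro ⟨h1, h2⟩; exact ⟨h1, hY'X h2⟩
      · rintro ⟨h1, h2⟩; exact ⟨h1, Or.inl ⟨h2, by omega⟩⟩) hred
  rw [hR _ hRt] at key
  exact hne _ (res_coe_sub _ _) hN key

end Tm

namespace Tm
variable {le : Tm → Tm → Prop}

theorem Bad.sub {p X Y} (h : Bad le p X) (hY : Y ⊆ X) (hi : Y.Infinite) : Bad le p Y :=
  ⟨hi, fun A hA => h.mono A (hA.trans hY), fun A hA => h.absorb A (hA.trans hY),
    fun A hA => h.total A (hA.trans hY), fun A hA => h.bad A (hA.trans hY),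
    fun s hs => h.smooth s (hs.trans hY), h.emp⟩

theorem exists_ext {X : Set ℕ} (hX : X.Infinite) (s : Finset ℕ) (hs : ↑s ⊆ X) :
    ∃ A ⊆ X, A.Infinite ∧ ∃ N, res A N = s := by
  refine ⟨↑s ∪ {x | x ∈ X ∧ ∀ y ∈ s, y < x}, ?_, ?_, s.sup Nat.succ, ?_⟩
  · rintro x (h | h)
    · exact hs h
    · exact h.1
  · refine Set.Infinite.mono ?_ (hX.sdiff (Set.finite_Iic (s.sup id)))
    rintro x ⟨h1, h2⟩
    right
    refine ⟨h1, fun y hy => ?_⟩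
    have : y ≤ s.sup id := Finset.le_sup (f := id) hy
    simp only [Set.mem_Iic] at h2
    omega
  · ext x
    simp only [mem_res, Finset.lt_sup_iff]
    constructor
    · rintro ⟨⟨y, hy, hxy⟩, h | h⟩
      · exact h
      · have := h.2 y hy
        omega
    · intro h
      exact ⟨⟨x, h, Nat.lt_succ_self x⟩, Or.inl h⟩

inductive WW (U : Ultrafilter ℕ) (D C : Finset ℕ → Prop) : Finset ℕ → Prop
  | dec (s) : D s → C s → WW U D C s
  | lim (s) (V : Set ℕ) : ¬ D s → V ∈ U → (∀ n ∈ V, WW U D C (insert n s)) → WW U D C s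

theorem ramsey {p X} (hp : Bad le p X) (c : Tm → Prop) : ∃ H ⊆ X, H.Infinite ∧
    ((∀ s : Finset ℕ, ↑s ⊆ H → (p s).2 = true → c (p s).1) ∨
     (∀ s : Finset ℕ, ↑s ⊆ H → (p s).2 = true → ¬ c (p s).1)) := by
  classical
  have : (Filter.cofinite ⊓ Filter.principal X).NeBot :=
    Filter.cofinite_inf_principal_neBot_iff.2 hp.inf
  let U : Ultrafilter ℕ := Ultrafilter.of (Filter.cofinite ⊓ Filter.principal X)
  have hU : (U : Filter ℕ) ≤ Filter.cofinite ⊓ Filter.principal X := Ultrafilter.of_le _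
  have hUX : X ∈ U := (hU.trans inf_le_right) (Filter.mem_principal_self X)
  have hUc : ∀ m, {n | m < n} ∈ U := by
    intro m
    apply (hU.trans inf_le_left)
    rw [Filter.mem_cofinite]
    refine (Set.finite_Iic m).subset ?_
    intro x hx
    simpa using hx
  let D : Finset ℕ → Prop := fun s => (p s).2 = true
  let C : Finset ℕ → Prop := fun s => c (p s).1
  let W := WW U D C
  have hWD : ∀ s, D s → (W s ↔ C s) := by
    intro s hs
    constructor
    · intro h
      cases h with
      | dec _ _ h => exact h
      | lim _ V h => exact absurd hs h
    · exact fun h => WW.dec s hs h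
  have hE : ∀ s, ¬ D s → {n | W s ↔ W (insert n s)} ∈ U := by
    intro s hs
    by_cases hc : {n | W (insert n s)} ∈ U
    · have hW : W s := WW.lim s _ hs hc (fun n hn => hn)
      filter_upwards [hc] with n hn
      exact ⟨fun _ => hn, fun _ => hW⟩
    · have hnW : ¬ W s := by
        intro h
        cases h with
        | dec _ h _ => exact hs h
        | lim _ V _ hV h =>
          apply hc
          filter_upwards [hV] with n hn
          exact h n hn
      have := Ultrafilter.compl_mem_iff_notMem.2 hc
      filter_upwards [this] with n hn
      exact ⟨fun h => absurd h hnW, fun h => absurd h hn⟩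
  have hG : ∀ m, ∃ n, n ∈ X ∧ m < n ∧ ∀ s ∈ (Finset.range (m+1)).powerset,
      (¬ D s → (W s ↔ W (insert n s))) := by
    intro m
    have h1 : {n | ∀ s ∈ (Finset.range (m+1)).powerset, (¬ D s → (W s ↔ W (insert n s)))} ∈ U := by
      refine (Filter.eventually_all_finset (l := (U : Filter ℕ)) (Finset.range (m+1)).powerset).2 ?_
      intro s _
      by_cases hs : D s
      · exact Filter.Eventually.of_forall fun n h => absurd hs h
      · filter_upwards [hE s hs] with n hn _
        exact hn
    obtain ⟨n, h⟩ := Ultrafilter.nonempty_of_mem (Filter.inter_mem (Filter.inter_mem hUX (hUc m)) h1)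
    exact ⟨n, h.1.1, h.1.2, h.2⟩
  choose nx hnX hnlt hnE using hG
  let k : ℕ → ℕ := fun n => Nat.rec (nx 0) (fun _ m => nx m) n
  have hk : ∀ n, k (n+1) = nx (k n) := fun n => rfl
  have hkm : StrictMono k := strictMono_nat_of_lt_succ fun n => hnlt _
  have hkX : ∀ n, k n ∈ X := by
    intro n
    cases n with
    | zero => exact hnX _
    | succ n => exact hnX _
  have hkE : ∀ n, ∀ s : Finset ℕ, ↑s ⊆ Set.range k → (∀ x ∈ s, x < k n) → ¬ D s →
      (W s ↔ W (insert (k n) s)) := by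
    intro n s hs hlt hd
    cases n with
    | zero =>
      refine hnE 0 s ?_ hd
      rw [Finset.mem_powerset]
      intro x hx
      obtain ⟨j, rfl⟩ := hs hx
      have := hlt _ hx
      have h2 := (hkm.lt_iff_lt (a := j) (b := 0)).1 this
      omega
    | succ n =>
      refine hnE (k n) s ?_ hd
      rw [Finset.mem_powerset]
      intro x hx
      obtain ⟨j, rfl⟩ := hs hx
      have := hlt _ hx
      have h2 := (hkm.lt_iff_lt (a := j) (b := n+1)).1 this
      rw [Finset.mem_range]
      have : k j ≤ k n := hkm.monotone (by omega)
      omega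
  have hHX : Set.range k ⊆ X := by rintro _ ⟨n, rfl⟩; exact hkX n
  have hWA : ∀ A ⊆ Set.range k, ∀ N, (W (res A N) ↔ W ∅) := by
    intro A hA N
    induction N with
    | zero => rw [res_zero]
    | succ N ih =>
      rw [← ih]
      by_cases hNA : N ∈ A
      · have e : res A (N+1) = insert N (res A N) := by
          ext y
          simp only [mem_res, Finset.mem_insert]
          constructor
          · rintro ⟨h1, h2⟩
            by_cases hy : y = N
            · exact Or.inl hy
            · exact Or.inr ⟨by omega, h2⟩
          · rintro (rfl | h)
            · exact ⟨by omega, hNA⟩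
            · exact ⟨by omega, h.2⟩
        by_cases hd : D (res A N)
        · have h1 := hp.absorb A (hA.trans hHX) N (N+1) (by omega) hd
          have hd' : D (res A (N+1)) := by
            show (p (res A (N+1))).2 = true
            rw [h1]; exact hd
          rw [hWD _ hd, hWD _ hd']
          show c (p (res A (N+1))).1 ↔ c (p (res A N)).1
          rw [h1]
        · obtain ⟨n, rfl⟩ := hA hNA
          rw [e]
          exact (hkE n (res A (k n)) ((res_coe_sub _ _).trans hA) (fun x hx => (mem_res.1 hx).1) hd).symm
      · have e : res A (N+1) = res A N := by
          ext y
          simp only [mem_res]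
          constructor
          · rintro ⟨h1, h2⟩
            have : y ≠ N := by rintro rfl; exact hNA h2
            exact ⟨by omega, h2⟩
          · rintro h
            exact ⟨by omega, h.2⟩
        rw [e]
  have hHi : (Set.range k).Infinite := Set.infinite_range_of_injective hkm.injective
  have hfin : ∀ s : Finset ℕ, ↑s ⊆ Set.range k → (p s).2 = true → (c (p s).1 ↔ W ∅) := by
    intro s hs hd
    obtain ⟨A, hA, _, N, rfl⟩ := exists_ext hHi s hs
    rw [← hWA A hA N]
    exact (hWD _ hd).symm
  refine ⟨Set.range k, hHX, hHi, ?_⟩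
  by_cases hW : W ∅
  · exact Or.inl fun s hs hd => (hfin s hs hd).2 hW
  · exact Or.inr fun s hs hd h => hW ((hfin s hs hd).1 h)

theorem Bad.bad' {p X} (hp : Bad le p X) (s : Finset ℕ) (hs : ↑s ⊆ X) (h1 : (p s).2 = true)
    (h2 : (p (ftl s)).2 = true) : ¬ le (p s).1 (p (ftl s)).1 := by
  obtain ⟨A, hA, hi, N, rfl⟩ := exists_ext hp.inf s hs
  rw [← res_tl] at h2 ⊢
  exact hp.bad A hA hi N h1 h2

theorem Bad.not_leaf (hleaf : ∀ t, le leaf t) {p X} (hp : Bad le p X) (s : Finset ℕ) (hs : ↑s ⊆ X)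
    (h1 : (p s).2 = true) : (p s).1 ≠ leaf := by
  obtain ⟨A, hA, hi, N, rfl⟩ := exists_ext hp.inf s hs
  obtain ⟨M, hM⟩ := hp.total (tl A) ((tl_sub A).trans hA) (tl_inf hi)
  have e1 := hp.absorb A hA N (max N M) (by omega) h1
  have e2 := hp.absorb (tl A) ((tl_sub A).trans hA) M (max N M) (by omega) hM
  have := hp.bad A hA hi (max N M) (by rw [e1]; exact h1) (by rw [e2]; exact hM)
  intro h
  apply this
  rw [e1, h]
  exact hleaf _

open Classical in
noncomputable def childSel (le : Tm → Tm → Prop) (u v : Tm) : Tm :=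
  if h : ∃ c, Ch c u ∧ ∀ d, Ch d v → ¬ le c d then h.choose else u

open Classical in
noncomputable def GG (le : Tm → Tm → Prop) (a b : Tm × Bool) : Tm × Bool :=
  if a.2 = true then (if b.2 = true then (childSel le a.1 b.1, true) else (a.1, false)) else a

theorem no_bad (htr : ∀ a b c, le a b → le b c → le a c) (hch : ∀ b f n, le (f n) (node b f))
    (hleaf : ∀ t, le leaf t)
    (hnode : ∀ b f g, (∀ n, ∃ m, le (f n) (g m)) → le (node b f) (node b g))
    {p₀ X₀} (h0 : Bad le p₀ X₀) : False := by
  classical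
  obtain ⟨p, X, hp, hfix⟩ := fusion h0
  obtain ⟨H, hHX, hHi, hH⟩ := ramsey hp (fun t => ∃ f, t = node true f)
  obtain ⟨b, hb⟩ : ∃ b, ∀ s : Finset ℕ, ↑s ⊆ H → (p s).2 = true → ∃ f, (p s).1 = node b f := by
    rcases hH with h | h
    · exact ⟨true, h⟩
    · refine ⟨false, fun s hs hd => ?_⟩
      have h1 := hp.not_leaf hleaf s (hs.trans hHX) hd
      have h2 := h s hs hd
      cases hps : (p s).1 with
      | leaf => exact absurd hps h1
      | node e f =>
        cases e with
        | false => exact ⟨f, rfl⟩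
        | true => exact absurd ⟨f, hps⟩ h2
  have hpH := hp.sub hHX hHi
  let g : Finset ℕ → Tm × Bool := fun s => GG le (p s) (p (ftl s))
  have g1 : ∀ s, (p s).2 = false → g s = p s := by
    intro s hs; simp [g, GG, hs]
  have g2 : ∀ s, (p s).2 = true → (p (ftl s)).2 = false → g s = ((p s).1, false) := by
    intro s hs hs'; simp [g, GG, hs, hs']
  have g3' : ∀ s, (p s).2 = true → (p (ftl s)).2 = true →
      g s = (childSel le (p s).1 (p (ftl s)).1, true) := by
    intro s hs hs'; simp [g, GG, hs, hs']
  have g3 : ∀ s : Finset ℕ, ↑s ⊆ H → (p s).2 = true → (p (ftl s)).2 = true →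
      ∃ c, g s = (c, true) ∧ Ch c (p s).1 ∧ ∀ d, Ch d (p (ftl s)).1 → ¬ le c d := by
    intro s hsH hs hs'
    have hex : ∃ c, Ch c (p s).1 ∧ ∀ d, Ch d (p (ftl s)).1 → ¬ le c d := by
      by_contra hcon
      push Not at hcon
      apply hpH.bad' s hsH hs hs'
      obtain ⟨f, hf⟩ := hb s hsH hs
      obtain ⟨f', hf'⟩ := hb (ftl s) (fun x hx => hsH (mem_ftl.1 hx).1) hs'
      rw [hf, hf'] at hcon ⊢
      apply hnode
      intro n
      obtain ⟨d, ⟨e, f2, m, hd, rfl⟩, h2⟩ := hcon (f n) ⟨b, f, n, rfl, rfl⟩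
      cases hd
      exact ⟨m, h2⟩
    refine ⟨hex.choose, ?_, hex.choose_spec⟩
    rw [g3' s hs hs', childSel, dif_pos hex]
  have hcs : ∀ u v, childSel le u v = u ∨ Ch (childSel le u v) u := by
    intro u v
    unfold childSel
    split_ifs with h
    · exact Or.inr h.choose_spec.1
    · exact Or.inl rfl
  have htrue : ∀ a : Tm × Bool, a.2 = true → a = (a.1, true) := by
    rintro ⟨a, b⟩ h; simp at h; simp [h]
  have hred : Red g p := by
    intro s
    cases hs : (p s).2 with
    | false => rw [g1 s hs]; exact ⟨sle_refl _, fun h => by rw [hs] at h; exact h⟩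
    | true =>
      refine ⟨?_, fun _ => rfl⟩
      cases hs' : (p (ftl s)).2 with
      | false =>
        rw [g2 s hs hs']
        right
        conv => rhs; rw [htrue _ hs]
        exact Prod.Lex.right _ ⟨rfl, rfl⟩
      | true =>
        rw [g3' s hs hs']
        rcases hcs (p s).1 (p (ftl s)).1 with h | h
        · left; rw [h]; exact (htrue _ hs).symm
        · right
          conv => rhs; rw [htrue _ hs]
          exact Prod.Lex.left _ _ (Relation.TransGen.single h)
  have hdec : ∀ s, (g s).2 = true → (p s).2 = true ∧ (p (ftl s)).2 = true := by
    intro s h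
    have h1 := (hred s).2 h
    refine ⟨h1, ?_⟩
    by_contra hc
    rw [g2 s h1 (by simpa using hc)] at h
    cases h
  have hgeq : ∀ A ⊆ H, ∀ M N, M ≤ N → (p (res A M)).2 = true → (p (res (tl A) M)).2 = true →
      g (res A N) = g (res A M) := by
    intro A hA M N hMN h1 h2
    show GG le (p (res A N)) (p (ftl (res A N))) = GG le (p (res A M)) (p (ftl (res A M)))
    rw [← res_tl, ← res_tl, hpH.absorb A hA M N hMN h1,
      hpH.absorb (tl A) ((tl_sub A).trans hA) M N hMN h2]
  have hgbad : Bad le g H := by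
    refine ⟨hHi, ?_, ?_, ?_, ?_, ?_, ?_⟩
    · intro A hA M N hMN
      have hNH : ↑(res A N) ⊆ H := (res_coe_sub _ _).trans hA
      cases hM : (p (res A M)).2 with
      | false =>
        rw [g1 _ hM]
        exact sle_trans (hred _).1 (hpH.mono A hA M N hMN)
      | true =>
        have e := hpH.absorb A hA M N hMN hM
        have hN : (p (res A N)).2 = true := by rw [e]; exact hM
        cases hM' : (p (ftl (res A M))).2 with
        | false =>
          rw [g2 _ hM hM']
          cases hN' : (p (ftl (res A N))).2 with
          | false => rw [g2 _ hN hN', e]; exact sle_refl _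
          | true =>
            obtain ⟨c, hc, hc', _⟩ := g3 _ hNH hN hN'
            rw [hc]
            right
            rw [← e]
            exact Prod.Lex.left _ _ (Relation.TransGen.single hc')
        | true =>
          rw [← res_tl] at hM'
          rw [hgeq A hA M N hMN hM hM']
          exact sle_refl _
    · intro A hA M N hMN hd
      obtain ⟨h1, h2⟩ := hdec _ hd
      rw [← res_tl] at h2
      exact hgeq A hA M N hMN h1 h2
    · intro A hA hAi
      obtain ⟨N1, hN1⟩ := hpH.total A hA hAi
      obtain ⟨N2, hN2⟩ := hpH.total (tl A) ((tl_sub A).trans hA) (tl_inf hAi)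
      refine ⟨max N1 N2, ?_⟩
      rw [g3']
      · rw [hpH.absorb A hA N1 _ (by omega) hN1]; exact hN1
      · rw [← res_tl, hpH.absorb (tl A) ((tl_sub A).trans hA) N2 _ (by omega) hN2]; exact hN2
    · intro A hA hAi N hd1 hd2
      have hA1 : ↑(res A N) ⊆ H := (res_coe_sub _ _).trans hA
      have hA2 : ↑(res (tl A) N) ⊆ H := (res_coe_sub _ _).trans ((tl_sub A).trans hA)
      obtain ⟨a1, a2⟩ := hdec _ hd1
      obtain ⟨b1, b2⟩ := hdec _ hd2
      obtain ⟨c, hc1, hc2, hc3⟩ := g3 _ hA1 a1 a2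
      obtain ⟨d, hd1', hd2', _⟩ := g3 _ hA2 b1 b2
      rw [hc1, hd1']
      apply hc3
      rw [← res_tl]
      exact hd2'
    · intro s hs hd
      obtain ⟨h1, h2⟩ := hdec _ hd
      rw [g3' s (hpH.smooth s hs h1) h1]
    · rw [g1 _ hp.emp]; exact hp.emp
  refine minimal htr hch hp hfix hgbad hHX hred ?_
  intro s hs hd heq
  cases hs' : (p (ftl s)).2 with
  | false =>
    rw [g2 s hd hs'] at heq
    rw [← heq] at hd
    cases hd
  | true =>
    obtain ⟨c, hc1, hc2, _⟩ := g3 s hs hd hs'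
    rw [hc1] at heq
    have : c = (p s).1 := by rw [← heq]
    rw [this] at hc2
    exact ch_wf.irrefl.irrefl _ hc2

theorem wqo (htr : ∀ a b c, le a b → le b c → le a c) (hch : ∀ b f n, le (f n) (node b f))
    (hleaf : ∀ t, le leaf t)
    (hnode : ∀ b f g, (∀ n, ∃ m, le (f n) (g m)) → le (node b f) (node b g))
    (t : ℕ → Tm) : ∃ i j, i < j ∧ le (t i) (t j) := by
  classical
  by_contra hcon
  push Not at hcon
  let p : Finset ℕ → Tm × Bool := fun s =>
    if h : s.Nonempty then (t (s.min' h), true) else (node true t, false)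
  have p1 : ∀ s (h : s.Nonempty), p s = (t (s.min' h), true) := fun s h => dif_pos h
  have p0 : p ∅ = (node true t, false) := by simp [p]
  have pd : ∀ s, (p s).2 = true → s.Nonempty := by
    intro s h
    by_contra hc
    rw [Finset.not_nonempty_iff_eq_empty] at hc
    rw [hc, p0] at h
    cases h
  have hres : ∀ (A : Set ℕ) M N, M ≤ N → (p (res A M)).2 = true → p (res A N) = p (res A M) := by
    intro A M N hMN h
    have h1 := pd _ h
    have h2 : (res A N).Nonempty := by
      obtain ⟨y, hy⟩ := h1
      rw [mem_res] at hy
      exact ⟨y, mem_res.2 ⟨by omega, hy.2⟩⟩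
    rw [p1 _ h1, p1 _ h2]
    congr 2
    apply le_antisymm
    · apply Finset.min'_le
      have := mem_res.1 (Finset.min'_mem _ h1)
      exact mem_res.2 ⟨by omega, this.2⟩
    · apply Finset.min'_le
      have h3 := mem_res.1 (Finset.min'_mem _ h2)
      refine mem_res.2 ⟨?_, h3.2⟩
      have h4 := mem_res.1 (Finset.min'_mem _ h1)
      have h5 := Finset.min'_le (res A N) _ (mem_res.2 ⟨by omega, h4.2⟩ : (res A M).min' h1 ∈ res A N)
      omega
  refine no_bad htr hch hleaf hnode (p₀ := p) (X₀ := Set.univ)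
    ⟨Set.infinite_univ, ?_, fun A _ => hres A, ?_, ?_, ?_, ?_⟩
  · intro A _ M N hMN
    by_cases h : (p (res A M)).2 = true
    · rw [hres A M N hMN h]; exact sle_refl _
    · have h1 : res A M = ∅ := by
        by_contra hc
        rw [p1 _ (Finset.nonempty_iff_ne_empty.2 hc)] at h
        exact h rfl
      rw [h1, p0]
      by_cases h2 : (res A N).Nonempty
      · right
        rw [p1 _ h2]
        exact Prod.Lex.left _ _ (Relation.TransGen.single ⟨true, t, _, rfl, rfl⟩)
      · rw [Finset.not_nonempty_iff_eq_empty.1 h2, p0]; exact sle_refl _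
  · intro A _ hAi
    obtain ⟨y, hy⟩ := hAi.nonempty
    exact ⟨y+1, by rw [p1 _ ⟨y, mem_res.2 ⟨by omega, hy⟩⟩]⟩
  · intro A _ _ N h1 h2
    have h1 := pd _ h1
    have h2 := pd _ h2
    rw [p1 _ h1, p1 _ h2]
    apply hcon
    have h3 := Finset.min'_mem _ h2
    obtain ⟨h4, h5, y, hy, hlt⟩ := mem_res.1 h3
    have := Finset.min'_le (res A N) y (mem_res.2 ⟨by omega, hy⟩)
    omega
  · intro s _ h
    obtain ⟨y, hy⟩ := pd _ h
    rw [p1 s ⟨y, (mem_ftl.1 hy).1⟩]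
  · rw [p0]

end Tm


def ltb {X : Type u} [LinearOrder X] (b : Bool) (x y : X) : Prop :=
  match b with
  | true => x < y
  | false => y < x

namespace Tm
section
variable {X : Type u} [LinearOrder X] {Y : Type v} [LinearOrder Y]

def Emb : Tm → Set X → Prop
  | leaf, S => S.Nonempty
  | node b f, S => ∃ I : ℕ → Set X, (∀ n, I n ⊆ S) ∧
      (∀ m n, m < n → ∀ x ∈ I m, ∀ y ∈ I n, ltb b x y) ∧ ∀ m K, ∃ k, K ≤ k ∧ Emb (f m) (I k)

theorem Emb.mono {t : Tm} {S T : Set X} (h : Emb t S) (hST : S ⊆ T) : Emb t T := by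
  cases t with
  | leaf => exact Set.Nonempty.mono hST h
  | node b f =>
    obtain ⟨I, h1, h2, h3⟩ := h
    exact ⟨I, fun n => (h1 n).trans hST, h2, h3⟩

theorem Emb.nonempty {t : Tm} {S : Set X} (h : Emb t S) : S.Nonempty := by
  induction t generalizing S with
  | leaf => exact h
  | node b f ih =>
    obtain ⟨I, h1, h2, h3⟩ := h
    obtain ⟨k, _, hk⟩ := h3 0 0
    exact (ih 0 hk).mono (h1 k)

theorem ltb_map {b : Bool} {h : X → Y} {S : Set X} (hh : StrictMonoOn h S) {x y : X}
    (hx : x ∈ S) (hy : y ∈ S) (hxy : ltb b x y) : ltb b (h x) (h y) := by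
  cases b
  · exact hh hy hx hxy
  · exact hh hx hy hxy

theorem Emb.image {t : Tm} {S : Set X} (h : Emb t S) {g : X → Y} (hg : StrictMonoOn g S) :
    Emb t (g '' S) := by
  induction t generalizing S with
  | leaf => exact Set.Nonempty.image g h
  | node b f ih =>
    obtain ⟨I, h1, h2, h3⟩ := h
    refine ⟨fun n => g '' I n, fun n => Set.image_mono (h1 n), ?_, ?_⟩
    · rintro m n hmn _ ⟨x, hx, rfl⟩ _ ⟨y, hy, rfl⟩
      exact ltb_map hg (h1 _ hx) (h1 _ hy) (h2 m n hmn x hx y hy)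
    · intro m K
      obtain ⟨k, hk, hk'⟩ := h3 m K
      exact ⟨k, hk, ih m hk' (hg.mono (h1 k))⟩

theorem Emb.split {t : Tm} {S L U : Set X} (h : Emb t S) (hS : S ⊆ L ∪ U)
    (hLU : ∀ x ∈ L, ∀ y ∈ U, x < y) : Emb t L ∨ Emb t U := by
  cases t with
  | leaf =>
    obtain ⟨x, hx⟩ := h
    rcases hS hx with h | h
    · exact Or.inl ⟨x, h⟩
    · exact Or.inr ⟨x, h⟩
  | node b f =>
    obtain ⟨I, h1, h2, h3⟩ := h
    have tail : ∀ (V : Set X) k0, (∀ n, k0 < n → I n ⊆ V) → Emb (node b f) V := by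
      intro V k0 hV
      refine ⟨fun n => I (n + k0 + 1), fun n => hV _ (by omega), fun m n hmn => h2 _ _ (by omega), ?_⟩
      intro m K
      obtain ⟨k, hk, hk'⟩ := h3 m (K + k0 + 1)
      refine ⟨k - k0 - 1, by omega, ?_⟩
      have : k - k0 - 1 + k0 + 1 = k := by omega
      beta_reduce
      rw [this]; exact hk'
    cases b with
    | true =>
      by_cases hc : ∃ k0, ∃ u ∈ I k0, u ∈ U
      · obtain ⟨k0, w, hw, hwU⟩ := hc
        right
        refine tail U k0 fun n hn y hy => ?_
        have h4 : w < y := h2 k0 n hn w hw y hy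
        rcases hS (h1 n hy) with h | h
        · exact absurd (hLU y h w hwU) (not_lt.2 h4.le)
        · exact h
      · push Not at hc
        left
        exact tail L 0 fun n _ y hy => (hS (h1 n hy)).resolve_right (hc n y hy)
    | false =>
      by_cases hc : ∃ k0, ∃ u ∈ I k0, u ∈ L
      · obtain ⟨k0, w, hw, hwU⟩ := hc
        left
        refine tail L k0 fun n hn y hy => ?_
        have h4 : y < w := h2 k0 n hn w hw y hy
        rcases hS (h1 n hy) with h | h
        · exact h
        · exact absurd (hLU w hwU y h) (not_lt.2 h4.le)
      · push Not at hc
        right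
        exact tail U 0 fun n _ y hy => (hS (h1 n hy)).resolve_left (hc n y hy)

variable (X) in
def Le (t t' : Tm) : Prop := ∀ S : Set X, Emb t' S → Emb t S

theorem le_wqo (t : ℕ → Tm) : ∃ i j, i < j ∧ Le X (t i) (t j) := by
  refine wqo (le := Le X) ?_ ?_ ?_ ?_ t
  · intro a b c h1 h2 S hS; exact h1 S (h2 S hS)
  · rintro b f n S ⟨I, h1, h2, h3⟩
    obtain ⟨k, _, hk⟩ := h3 n 0
    exact hk.mono (h1 k)
  · intro t S hS; exact hS.nonempty
  · rintro b f g h S ⟨I, h1, h2, h3⟩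
    refine ⟨I, h1, h2, fun m K => ?_⟩
    obtain ⟨m', hm'⟩ := h m
    obtain ⟨k, hk, hk'⟩ := h3 m' K
    exact ⟨k, hk, hm' _ hk'⟩

def EmbS (S : Set X) (W : Set Y) : Prop := ∃ f : X → Y, StrictMonoOn f S ∧ Set.MapsTo f S W

theorem Emb.embS {t : Tm} {S : Set X} {W : Set Y} (h : Emb t S) (hSW : EmbS S W) : Emb t W := by
  obtain ⟨f, h1, h2⟩ := hSW
  exact (h.image h1).mono h2.image_subset

theorem EmbS.mono {S S' : Set X} {W W' : Set Y} (h : EmbS S W) (h1 : S' ⊆ S) (h2 : W ⊆ W') :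
    EmbS S' W' := by
  obtain ⟨f, hf1, hf2⟩ := h
  exact ⟨f, hf1.mono h1, fun x hx => h2 (hf2 (h1 hx))⟩

theorem EmbS.refl (S : Set X) : EmbS S S := ⟨id, strictMonoOn_id, fun _ h => h⟩

theorem EmbS.glue [Nonempty Y] {ι : Type*} {S : ι → Set X} {T : ι → Set Y} (h : ∀ i, EmbS (S i) (T i))
    (hG : ∀ i j, i ≠ j → ∀ x ∈ S i, ∀ y ∈ S j, x < y → ∀ x' ∈ T i, ∀ y' ∈ T j, x' < y') :
    EmbS (⋃ i, S i) (⋃ i, T i) := by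
  classical
  choose f hf1 hf2 using h
  have hidx : ∀ x : X, ∃ y : Y, ∀ _ : x ∈ ⋃ i, S i, ∃ i, x ∈ S i ∧ y = f i x := by
    intro x
    by_cases hx : x ∈ ⋃ i, S i
    · obtain ⟨i, hi⟩ := Set.mem_iUnion.1 hx
      exact ⟨f i x, fun _ => ⟨i, hi, rfl⟩⟩
    · exact ⟨Classical.arbitrary Y, fun h => absurd h hx⟩
  choose F hF using hidx
  refine ⟨F, ?_, ?_⟩
  · intro x hx y hy hxy
    obtain ⟨i, hi, ei⟩ := hF x hx
    obtain ⟨j, hj, ej⟩ := hF y hy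
    rw [ei, ej]
    by_cases hij : i = j
    · subst hij; exact hf1 i hi hj hxy
    · exact hG i j hij x hi y hj hxy _ (hf2 i hi) _ (hf2 j hj)
  · intro x hx
    obtain ⟨i, hi, ei⟩ := hF x hx
    rw [ei]
    exact Set.mem_iUnion.2 ⟨i, hf2 i hi⟩

theorem EmbS.empty [Nonempty Y] (W : Set Y) : EmbS (∅ : Set X) W :=
  ⟨fun _ => Classical.arbitrary Y, by intro x hx; exact absurd hx (by simp), by intro x hx; exact absurd hx (by simp)⟩

theorem EmbS.union [Nonempty Y] {L U : Set X} {A B : Set Y} (h1 : EmbS L A) (h2 : EmbS U B)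
    (hLU : ∀ x ∈ L, ∀ y ∈ U, x < y) (hAB : ∀ x ∈ A, ∀ y ∈ B, x < y) : EmbS (L ∪ U) (A ∪ B) := by
  rw [Set.union_eq_iUnion, Set.union_eq_iUnion]
  apply EmbS.glue
  · rintro (_ | _)
    · exact h2
    · exact h1
  · rintro (_ | _) (_ | _) hij x hx y hy hxy
    · exact absurd rfl hij
    · exact absurd (hLU y hy x hx) (not_lt.2 hxy.le)
    · exact hAB
    · exact absurd rfl hij

def Bd (t : Tm) (U : Set X) : Prop := ∀ V : Set X, Emb t V → EmbS U V

inductive FS : List Tm → Set X → Prop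
  | nil : FS [] ∅
  | cons {l t L U} : FS l L → Emb t U → Bd t U → (∀ x ∈ L, ∀ y ∈ U, x < y) → FS (t :: l) (L ∪ U)

def IsFS (S : Set X) : Prop := ∃ l, FS l S

theorem FS.union {l l' : List Tm} {A B : Set X} (hA : FS l A) (hB : FS l' B)
    (hAB : ∀ x ∈ A, ∀ y ∈ B, x < y) : FS (l' ++ l) (A ∪ B) := by
  induction hB with
  | nil => simpa using hA
  | cons h1 h2 h3 h4 ih =>
    rw [← Set.union_assoc]
    refine FS.cons (ih fun x hx y hy => hAB x hx y (Or.inl hy)) h2 h3 ?_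
    rintro x (hx | hx) y hy
    · exact hAB x hx y (Or.inr hy)
    · exact h4 x hx y hy

theorem IsFS.union {A B : Set X} (hA : IsFS A) (hB : IsFS B)
    (hAB : ∀ x ∈ A, ∀ y ∈ B, x < y) : IsFS (A ∪ B) := by
  obtain ⟨l, hl⟩ := hA
  obtain ⟨l', hl'⟩ := hB
  exact ⟨_, hl.union hl' hAB⟩

theorem IsFS.unionb {b : Bool} {A B : Set X} (hA : IsFS A) (hB : IsFS B)
    (hAB : ∀ x ∈ A, ∀ y ∈ B, ltb b x y) : IsFS (A ∪ B) := by
  cases b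
  · rw [Set.union_comm]; exact hB.union hA fun x hx y hy => hAB y hy x hx
  · exact hA.union hB hAB

theorem IsFS.of_rep {t : Tm} {U : Set X} (h1 : Emb t U) (h2 : Bd t U) : IsFS U := by
  have := FS.cons FS.nil h1 h2 (by intro x hx; exact absurd hx (by simp))
  rw [Set.empty_union] at this
  exact ⟨_, this⟩

theorem IsFS.empty : IsFS (∅ : Set X) := ⟨_, FS.nil⟩

theorem IsFS.singleton (x : X) : IsFS ({x} : Set X) := by
  refine IsFS.of_rep (t := leaf) ⟨x, rfl⟩ ?_
  rintro V ⟨y, hy⟩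
  refine ⟨fun _ => y, ?_, fun _ _ => hy⟩
  rintro a rfl b rfl h
  exact absurd h (lt_irrefl _)

theorem FS.emb {l : List Tm} {S : Set X} (h : FS l S) {t : Tm} (ht : t ∈ l) : Emb t S := by
  induction h with
  | nil => simp at ht
  | cons h1 h2 h3 h4 ih =>
    rcases List.mem_cons.1 ht with rfl | ht
    · exact h2.mono Set.subset_union_right
    · exact (ih ht).mono Set.subset_union_left

theorem FS.fit {b : Bool} {l : List Tm} {S : Set X} (h : FS l S) [Nonempty X] (J : ℕ → Set X)
    (hJ : ∀ m n, m < n → ∀ x ∈ J m, ∀ y ∈ J n, ltb b x y)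
    (hl : ∀ t ∈ l, ∀ K, ∃ k, K ≤ k ∧ Emb t (J k)) (K : ℕ) :
    ∃ K', K < K' ∧ EmbS S {x | ∃ k, K ≤ k ∧ k < K' ∧ x ∈ J k} := by
  induction h generalizing K with
  | nil => exact ⟨K+1, by omega, EmbS.empty _⟩
  | @cons l t L U h1 h2 h3 h4 ih =>
    have ih := ih fun t ht => hl t (List.mem_cons_of_mem _ ht)
    cases b with
    | true =>
      obtain ⟨K1, hK1, e1⟩ := ih K
      obtain ⟨k, hk, hk'⟩ := hl t List.mem_cons_self K1
      refine ⟨k+1, by omega, (e1.union (h3 _ hk') h4 ?_).mono subset_rfl ?_⟩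
      · rintro x ⟨j, hj1, hj2, hx⟩ y hy
        exact hJ j k (by omega) x hx y hy
      · rintro x (⟨j, hj1, hj2, hx⟩ | hx)
        · exact ⟨j, hj1, by omega, hx⟩
        · exact ⟨k, by omega, by omega, hx⟩
    | false =>
      obtain ⟨k, hk, hk'⟩ := hl t List.mem_cons_self K
      obtain ⟨K1, hK1, e1⟩ := ih (k+1)
      refine ⟨K1, by omega, (e1.union (h3 _ hk') h4 ?_).mono subset_rfl ?_⟩
      · rintro x ⟨j, hj1, hj2, hx⟩ y hy
        exact hJ k j (by omega) y hy x hx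
      · rintro x (⟨j, hj1, hj2, hx⟩ | hx)
        · exact ⟨j, by omega, by omega, hx⟩
        · exact ⟨k, by omega, by omega, hx⟩

theorem ltb_irrefl_of {b : Bool} {x y : X} (h : ltb b x y) (h' : ltb b y x) : False := by
  cases b
  · exact lt_asymm h h'
  · exact lt_asymm h h'

theorem IsFS.sum {b : Bool} (S : ℕ → Set X) (hS : ∀ n, IsFS (S n))
    (hord : ∀ m n, m < n → ∀ x ∈ S m, ∀ y ∈ S n, ltb b x y) : IsFS (⋃ n, S n) := by
  classical
  rcases isEmpty_or_nonempty X with hX | hX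
  · have : (⋃ n, S n) = ∅ := Set.eq_empty_of_isEmpty _
    rw [this]; exact IsFS.empty
  choose l hl using hS
  have hrec : ∃ N, ∀ n, N ≤ n → ∀ t ∈ l n, ∀ K, ∃ k, K ≤ k ∧ ∃ t' ∈ l k, Le X t t' := by
    by_contra hcon
    push Not at hcon
    choose n hn t ht K hK using hcon
    let N : ℕ → ℕ := fun i => Nat.rec 0 (fun _ m => max m (K m)) i
    have hN : ∀ i, N (i+1) = max (N i) (K (N i)) := fun i => rfl
    have hNm : Monotone N := monotone_nat_of_le_succ fun i => by rw [hN]; exact le_max_left _ _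
    obtain ⟨i, j, hij, hle⟩ := le_wqo (X := X) (fun i => t (N i))
    refine hK (N i) (n (N j)) ?_ (t (N j)) (ht _) hle
    have h1 : N (i+1) ≤ N j := hNm hij
    have h2 := hn (N j)
    have h3 : K (N i) ≤ N (i+1) := by rw [hN]; exact le_max_right _ _
    omega
  obtain ⟨N, hN⟩ := hrec
  have htail : IsFS {x | ∃ n, N ≤ n ∧ x ∈ S n} := by
    let TS : Set Tm := {t | ∃ n, N ≤ n ∧ t ∈ l n}
    by_cases hne : TS.Nonempty
    · have hc : TS.Countable := by
        have : TS ⊆ ⋃ n, {t | t ∈ l n} := by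
          rintro t ⟨n, _, ht⟩; exact Set.mem_iUnion.2 ⟨n, ht⟩
        refine (Set.countable_iUnion fun n => ?_).mono this
        exact (List.finite_toSet (l n)).countable
      obtain ⟨f, hf⟩ := hc.exists_eq_range hne
      have hfm : ∀ m, ∃ n, N ≤ n ∧ f m ∈ l n := by
        intro m
        have : f m ∈ TS := by rw [hf]; exact ⟨m, rfl⟩
        exact this
      have hfs : ∀ n, N ≤ n → ∀ t ∈ l n, ∃ m, f m = t := by
        intro n hn t ht
        have : t ∈ TS := ⟨n, hn, ht⟩
        rw [hf] at this
        exact this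
      refine IsFS.of_rep (t := node b f) ?_ ?_
      · refine ⟨fun k => S (N + k), fun n x hx => ⟨N + n, by omega, hx⟩,
          fun m n hmn => hord _ _ (by omega), ?_⟩
        intro m K
        obtain ⟨n, hn, hm⟩ := hfm m
        obtain ⟨k, hk, t', ht', hle⟩ := hN n hn (f m) hm (N + K)
        refine ⟨k - N, by omega, ?_⟩
        have : N + (k - N) = k := by omega
        beta_reduce
        rw [this]
        exact hle _ ((hl k).emb ht')
      · rintro V ⟨J, hJ1, hJ2, hJ3⟩
        have hfit : ∀ n K, ∃ K', K < K' ∧ EmbS (S (N + n)) {x | ∃ k, K ≤ k ∧ k < K' ∧ x ∈ J k} := by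
          intro n K
          refine (hl (N + n)).fit J hJ2 ?_ K
          intro t ht K
          obtain ⟨m, rfl⟩ := hfs (N + n) (by omega) t ht
          exact hJ3 m K
        choose K' hK' hfit using hfit
        let κ : ℕ → ℕ := fun n => Nat.rec 0 (fun i k => K' i k) n
        have hκ : ∀ n, κ (n+1) = K' n (κ n) := fun n => rfl
        have hκm : Monotone κ := monotone_nat_of_le_succ fun n => by rw [hκ]; exact (hK' _ _).le
        have := EmbS.glue (S := fun n => S (N + n))
          (T := fun n => {x | ∃ k, κ n ≤ k ∧ k < κ (n+1) ∧ x ∈ J k}) (fun n => hfit n (κ n)) ?_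
        · refine this.mono ?_ ?_
          · rintro x ⟨n, hn, hx⟩
            refine Set.mem_iUnion.2 ⟨n - N, ?_⟩
            have : N + (n - N) = n := by omega
            simp only [this]
            exact hx
          · intro x hx
            obtain ⟨n, k, _, _, hk⟩ := Set.mem_iUnion.1 hx
            exact hJ1 k hk
        · rintro i j hij x hx y hy hxy x' ⟨k, hk1, hk2, hk3⟩ y' ⟨k', hk1', hk2', hk3'⟩
          rcases lt_or_gt_of_ne hij with h | h
          · have h1 := hord (N + i) (N + j) (by omega) x hx y hy
            have h2 := hκm h
            have h3 := hJ2 k k' (by simp only [Nat.succ_eq_add_one] at h2; omega) _ hk3 _ hk3'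
            cases b
            · exact absurd h1 (not_lt.2 hxy.le)
            · exact h3
          · have h1 := hord (N + j) (N + i) (by omega) y hy x hx
            have h2 := hκm h
            have h3 := hJ2 k' k (by simp only [Nat.succ_eq_add_one] at h2; omega) _ hk3' _ hk3
            cases b
            · exact h3
            · exact absurd h1 (not_lt.2 hxy.le)
    · have : {x | ∃ n, N ≤ n ∧ x ∈ S n} = ∅ := by
        rw [Set.eq_empty_iff_forall_notMem]
        rintro x ⟨n, hn, hx⟩
        have h1 : l n = [] := by
          rw [List.eq_nil_iff_forall_not_mem]
          intro t ht
          exact hne ⟨t, n, hn, ht⟩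
        have h2 := hl n
        rw [h1] at h2
        generalize S n = Sn at h2 hx
        cases h2
        exact hx
      rw [this]; exact IsFS.empty
  have hdown : ∀ M, IsFS {x | ∃ n, M ≤ n ∧ x ∈ S n} → IsFS (⋃ n, S n) := by
    intro M
    induction M with
    | zero =>
      intro h
      have : (⋃ n, S n) = {x | ∃ n, 0 ≤ n ∧ x ∈ S n} := by ext; simp
      rw [this]; exact h
    | succ M ih =>
      intro h
      apply ih
      have : {x | ∃ n, M ≤ n ∧ x ∈ S n} = S M ∪ {x | ∃ n, M + 1 ≤ n ∧ x ∈ S n} := by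
        ext x
        constructor
        · rintro ⟨n, hn, hx⟩
          by_cases hnM : n = M
          · subst hnM; exact Or.inl hx
          · exact Or.inr ⟨n, by omega, hx⟩
        · rintro (hx | ⟨n, hn, hx⟩)
          · exact ⟨M, le_rfl, hx⟩
          · exact ⟨n, by omega, hx⟩
      rw [this]
      refine IsFS.unionb (b := b) ⟨_, hl M⟩ h ?_
      rintro x hx y ⟨n, hn, hy⟩
      exact hord M n (by omega) x hx y hy
  exact hdown N htail
end
end Tm

namespace Tm
section
variable {X : Type u} [LinearOrder X]

def Scat (X : Type u) [LinearOrder X] : Prop :=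
  ∀ D : Set X, D.Nontrivial → ¬ (∀ x ∈ D, ∀ y ∈ D, x < y → ∃ z ∈ D, x < z ∧ z < y)

def Rl (x y : X) : Prop := ∀ S ⊆ Set.uIcc x y, IsFS S

theorem Rl.refl (x : X) : Rl x x := by
  intro S hS
  rw [Set.uIcc_self] at hS
  rcases Set.subset_singleton_iff_eq.1 hS with rfl | rfl
  · exact IsFS.empty
  · exact IsFS.singleton x

theorem Rl.symm {x y : X} (h : Rl x y) : Rl y x := by
  intro S hS; rw [Set.uIcc_comm] at hS; exact h S hS

theorem Rl.sub {x y x' y' : X} (h : Rl x y) (hs : Set.uIcc x' y' ⊆ Set.uIcc x y) : Rl x' y' :=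
  fun S hS => h S (hS.trans hs)

theorem Rl.mid {x y z : X} (h1 : Rl x y) (h2 : Rl y z) (hxy : x ≤ y) (hyz : y ≤ z) : Rl x z := by
  intro S hS
  rw [Set.uIcc_of_le (hxy.trans hyz)] at hS
  have : S = (S ∩ Set.Iic y) ∪ (S ∩ Set.Ioi y) := by
    rw [← Set.inter_union_distrib_left, Set.Iic_union_Ioi, Set.inter_univ]
  rw [this]
  refine IsFS.union (h1 _ ?_) (h2 _ ?_) ?_
  · rw [Set.uIcc_of_le hxy]; rintro w ⟨hw, hw'⟩; exact ⟨(hS hw).1, hw'⟩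
  · rw [Set.uIcc_of_le hyz]; rintro w ⟨hw, hw'⟩; exact ⟨le_of_lt hw', (hS hw).2⟩
  · rintro a ⟨_, ha⟩ b ⟨_, hb⟩; exact lt_of_le_of_lt ha hb

theorem Rl.trans {x y z : X} (h1 : Rl x y) (h2 : Rl y z) : Rl x z := by
  rcases le_total x y with hxy | hxy <;> rcases le_total y z with hyz | hyz
  · exact h1.mid h2 hxy hyz
  · rcases le_total x z with hxz | hxz
    · exact h1.sub (by rw [Set.uIcc_of_le hxz, Set.uIcc_of_le hxy]; exact Set.Icc_subset_Icc_right hyz)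
    · exact h2.sub (by rw [Set.uIcc_of_ge hxz, Set.uIcc_of_ge hyz]; exact Set.Icc_subset_Icc_right hxy)
  · rcases le_total x z with hxz | hxz
    · exact h2.sub (by rw [Set.uIcc_of_le hxz, Set.uIcc_of_le hyz]; exact Set.Icc_subset_Icc_left hxy)
    · exact h1.sub (by rw [Set.uIcc_of_ge hxz, Set.uIcc_of_ge hxy]; exact Set.Icc_subset_Icc_left hyz)
  · exact (h2.symm.mid h1.symm hyz hxy).symm

theorem Rl.conv {x y z : X} (h : Rl x z) (hxy : x ≤ y) (hyz : y ≤ z) : Rl x y :=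
  h.sub (by rw [Set.uIcc_of_le hxy, Set.uIcc_of_le (hxy.trans hyz)]; exact Set.Icc_subset_Icc_right hyz)

theorem Rl.conv' {x y z : X} (h : Rl x z) (hxy : x ≤ y) (hyz : y ≤ z) : Rl y z :=
  h.sub (by rw [Set.uIcc_of_le hyz, Set.uIcc_of_le (hxy.trans hyz)]; exact Set.Icc_subset_Icc_left hxy)

theorem Rl.cls [Countable X] (x0 : X) (T : Set X) (hT : ∀ x ∈ T, Rl x0 x) : IsFS T := by
  have : Nonempty X := ⟨x0⟩
  obtain ⟨e, he⟩ := exists_surjective_nat X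
  have hup : IsFS (T ∩ Set.Ici x0) := by
    let S : ℕ → Set X := fun n => {x | x ∈ T ∧ x0 ≤ x ∧ (x ≤ e n ∧ Rl x0 (e n)) ∧
      ∀ m < n, ¬ (x ≤ e m ∧ Rl x0 (e m))}
    have h1 : T ∩ Set.Ici x0 = ⋃ n, S n := by
      ext x
      rw [Set.mem_iUnion]
      constructor
      · rintro ⟨h1, h2⟩
        have hex : ∃ n, x ≤ e n ∧ Rl x0 (e n) := by
          obtain ⟨n, rfl⟩ := he x
          exact ⟨n, le_rfl, hT _ h1⟩
        classical
        exact ⟨Nat.find hex, h1, h2, Nat.find_spec hex, fun m hm => Nat.find_min hex hm⟩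
      · rintro ⟨n, h1, h2, _⟩; exact ⟨h1, h2⟩
    rw [h1]
    refine IsFS.sum (b := true) S ?_ ?_
    · intro n
      by_cases hn : x0 ≤ e n ∧ Rl x0 (e n)
      · refine hn.2 _ ?_
        rintro x ⟨_, h2, h3, _⟩
        rw [Set.uIcc_of_le hn.1]
        exact ⟨h2, h3.1⟩
      · have : S n = ∅ := by
          rw [Set.eq_empty_iff_forall_notMem]
          rintro x ⟨_, h2, h3, _⟩
          exact hn ⟨h2.trans h3.1, h3.2⟩
        rw [this]; exact IsFS.empty
    · rintro m n hmn x ⟨_, _, hx, _⟩ y ⟨_, _, _, hy⟩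
      have := hy m hmn
      by_contra hc
      exact this ⟨(not_lt.1 hc).trans hx.1, hx.2⟩
  have hdn : IsFS (T ∩ Set.Iio x0) := by
    let S : ℕ → Set X := fun n => {x | x ∈ T ∧ x < x0 ∧ (e n ≤ x ∧ Rl x0 (e n)) ∧
      ∀ m < n, ¬ (e m ≤ x ∧ Rl x0 (e m))}
    have h1 : T ∩ Set.Iio x0 = ⋃ n, S n := by
      ext x
      rw [Set.mem_iUnion]
      constructor
      · rintro ⟨h1, h2⟩
        have hex : ∃ n, e n ≤ x ∧ Rl x0 (e n) := by
          obtain ⟨n, rfl⟩ := he x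
          exact ⟨n, le_rfl, hT _ h1⟩
        classical
        exact ⟨Nat.find hex, h1, h2, Nat.find_spec hex, fun m hm => Nat.find_min hex hm⟩
      · rintro ⟨n, h1, h2, _⟩; exact ⟨h1, h2⟩
    rw [h1]
    refine IsFS.sum (b := false) S ?_ ?_
    · intro n
      by_cases hn : e n ≤ x0 ∧ Rl x0 (e n)
      · refine hn.2 _ ?_
        rintro x ⟨_, h2, h3, _⟩
        rw [Set.uIcc_of_ge hn.1]
        exact ⟨h3.1, h2.le⟩
      · have : S n = ∅ := by
          rw [Set.eq_empty_iff_forall_notMem]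
          rintro x ⟨_, h2, h3, _⟩
          exact hn ⟨h3.1.trans h2.le, h3.2⟩
        rw [this]; exact IsFS.empty
    · rintro m n hmn x ⟨_, _, hx, _⟩ y ⟨_, _, _, hy⟩
      have := hy m hmn
      by_contra hc
      exact this ⟨hx.1.trans (not_lt.1 hc), hx.2⟩
  have : T = (T ∩ Set.Iio x0) ∪ (T ∩ Set.Ici x0) := by
    rw [← Set.inter_union_distrib_left, Set.Iio_union_Ici, Set.inter_univ]
  rw [this]
  refine hdn.union hup ?_
  rintro a ⟨_, ha⟩ b ⟨_, hb⟩; exact lt_of_lt_of_le ha hb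

def rlSetoid (X : Type u) [LinearOrder X] : Setoid X :=
  ⟨Rl, Rl.refl, Rl.symm, Rl.trans⟩

theorem decomp [Countable X] (hs : Scat X) (S : Set X) : IsFS S := by
  rcases isEmpty_or_nonempty X with hX | hX
  · rw [Set.eq_empty_of_isEmpty S]; exact IsFS.empty
  let rp : X → X := fun x => (Quotient.mk (rlSetoid X) x).out
  have hrp : ∀ x, Rl (rp x) x := fun x => Quotient.mk_out (s := rlSetoid X) x
  have hrp2 : ∀ x y, Rl x y → rp x = rp y := by
    intro x y h
    have : Quotient.mk (rlSetoid X) x = Quotient.mk (rlSetoid X) y := Quotient.sound h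
    show (Quotient.mk (rlSetoid X) x).out = (Quotient.mk (rlSetoid X) y).out
    rw [this]
  have hrr : ∀ x, rp (rp x) = rp x := fun x => hrp2 _ _ (hrp x)
  have hD : ∀ x ∈ Set.range rp, ∀ y ∈ Set.range rp, x < y → ∃ z ∈ Set.range rp, x < z ∧ z < y := by
    rintro x ⟨x, rfl⟩ y ⟨y, rfl⟩ hxy
    by_contra hcon
    push Not at hcon
    have hnr : ¬ Rl (rp x) (rp y) := by
      intro h
      have := hrp2 _ _ h
      rw [hrr, hrr] at this
      exact hxy.ne this
    apply hnr
    intro S hS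
    rw [Set.uIcc_of_le hxy.le] at hS
    have hcov : S = {z | z ∈ S ∧ Rl (rp x) z} ∪ {z | z ∈ S ∧ Rl (rp y) z} := by
      ext z
      constructor
      · intro hz
        rcases le_or_gt (rp z) (rp x) with h | h
        · exact Or.inl ⟨hz, (hrp z).conv' h (hS hz).1⟩
        · have := hcon (rp z) ⟨z, rfl⟩ h
          exact Or.inr ⟨hz, ((hrp z).symm.conv' (hS hz).2 this).trans (hrp z)⟩
      · rintro (h | h) <;> exact h.1
    rw [hcov]
    refine (Rl.cls (rp x) _ fun z hz => hz.2).union (Rl.cls (rp y) _ fun z hz => hz.2) ?_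
    rintro a ⟨ha, ha'⟩ b ⟨hb, hb'⟩
    by_contra hc
    exact hnr ((ha'.conv (hS hb).1 (not_lt.1 hc)).trans hb'.symm)
  have hsub : ∀ x y, rp x = rp y := by
    intro x y
    by_contra hne
    exact hs (Set.range rp) ⟨rp x, ⟨x, rfl⟩, rp y, ⟨y, rfl⟩, hne⟩ hD
  obtain ⟨x0⟩ := hX
  refine Rl.cls x0 S fun x _ => ?_
  have h1 := hrp x0
  rw [hsub x0 x] at h1
  exact h1.symm.trans (hrp x)

end
end Tm

namespace Tm
section

theorem Embeds.trans' {X : Type u} {Y : Type v} {Z : Type w} [LinearOrder X] [LinearOrder Y]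
    [LinearOrder Z] (h1 : Embeds X Y) (h2 : Embeds Y Z) : Embeds X Z := by
  obtain ⟨f, hf⟩ := h1
  obtain ⟨g, hg⟩ := h2
  exact ⟨g ∘ f, hg.comp hf⟩

theorem embeds_coe {X : Type u} [LinearOrder X] (S : Set X) : Embeds S X :=
  ⟨Subtype.val, fun _ _ h => h⟩

theorem embeds_iff {X : Type u} {Y : Type v} [LinearOrder X] [LinearOrder Y] {S : Set Y} :
    Embeds X S ↔ ∃ f : X → Y, StrictMono f ∧ ∀ x, f x ∈ S := by
  constructor
  · rintro ⟨f, hf⟩; exact ⟨fun x => f x, fun _ _ h => hf h, fun x => (f x).2⟩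
  · rintro ⟨f, hf, h⟩; exact ⟨fun x => ⟨f x, h x⟩, fun _ _ h => hf h⟩

theorem embeds_sub {X : Type u} [LinearOrder X] {S T : Set X} (h : S ⊆ T) : Embeds S T :=
  ⟨fun x => ⟨x.1, h x.2⟩, fun _ _ h => h⟩

theorem embS_iff {X : Type u} {Y : Type v} [LinearOrder X] [LinearOrder Y] {S : Set X} {T : Set Y}
    [Nonempty Y] : EmbS S T ↔ Embeds S T := by
  classical
  constructor
  · rintro ⟨f, h1, h2⟩
    exact ⟨fun x => ⟨f x, h2 x.2⟩, fun x y h => h1 x.2 y.2 h⟩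
  · rintro ⟨f, h⟩
    refine ⟨fun x => if hx : x ∈ S then f ⟨x, hx⟩ else Classical.arbitrary Y, ?_, ?_⟩
    · intro x hx y hy hxy
      simp only [hx, hy, dif_pos]
      exact h hxy
    · intro x hx
      simp only [hx, dif_pos]
      exact (f ⟨x, hx⟩).2

def Unt (X : Type u) [LinearOrder X] : Prop := ∀ (A B : Type u) [LinearOrder A] [LinearOrder B],
      Embeds A X → Embeds B X → Embeds X (B ×ₗ A) → Embeds X A ∨ Embeds X B

variable {X : Type u} [LinearOrder X]

theorem qcase [Countable X] (hs : ¬ Scat X) (S : Set X) : Embeds X S ∨ Embeds X ↥(Sᶜ) := by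
  have dq : ∀ E T : Set X, E ⊆ T → E.Nontrivial →
      (∀ x ∈ E, ∀ y ∈ E, x < y → ∃ z ∈ E, x < z ∧ z < y) → Embeds X T := by
    intro E T hET hE hd
    have : Nontrivial E := hE.coe_sort
    have : DenselyOrdered E := ⟨by
      rintro ⟨a, ha⟩ ⟨b, hb⟩ hab
      obtain ⟨z, hz, h1, h2⟩ := hd a ha b hb hab
      exact ⟨⟨z, hz⟩, h1, h2⟩⟩
    obtain ⟨φ⟩ := Order.embedding_from_countable_to_dense X E
    exact Embeds.trans' ⟨φ, φ.strictMono⟩ (embeds_sub hET)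
  unfold Scat at hs
  push Not at hs
  obtain ⟨D, hD, hd⟩ := hs
  by_cases hc : ∀ x ∈ D, ∀ y ∈ D, x < y → ∃ z ∈ D, z ∈ S ∧ x < z ∧ z < y
  · left
    refine dq (D ∩ S) S Set.inter_subset_right ?_ ?_
    · obtain ⟨x, hx, y, hy, hxy⟩ := hD.exists_lt
      obtain ⟨z, hz, hzS, h1, h2⟩ := hc x hx y hy hxy
      obtain ⟨z', hz', hzS', h1', h2'⟩ := hc z hz y hy h2
      exact ⟨z, ⟨hz, hzS⟩, z', ⟨hz', hzS'⟩, h1'.ne⟩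
    · rintro x ⟨hx, _⟩ y ⟨hy, _⟩ hxy
      obtain ⟨z, hz, hzS, h1, h2⟩ := hc x hx y hy hxy
      exact ⟨z, ⟨hz, hzS⟩, h1, h2⟩
  · right
    push Not at hc
    obtain ⟨x, hx, y, hy, hxy, hc⟩ := hc
    refine dq (D ∩ Set.Ioo x y) Sᶜ ?_ ?_ ?_
    · rintro z ⟨hz, hz1, hz2⟩ hzS
      exact absurd hz2 (not_lt.2 (hc z hz hzS hz1))
    · obtain ⟨z, hz, h1, h2⟩ := hd x hx y hy hxy
      obtain ⟨z', hz', h1', h2'⟩ := hd z hz y hy h2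
      exact ⟨z, ⟨hz, h1, h2⟩, z', ⟨hz', h1.trans h1', h2'⟩, h1'.ne⟩
    · rintro a ⟨ha, ha1, ha2⟩ b ⟨hb, hb1, hb2⟩ hab
      obtain ⟨z, hz, h1, h2⟩ := hd a ha b hb hab
      exact ⟨z, ⟨hz, ha1.trans h1, h2.trans hb2⟩, h1, h2⟩

theorem cutA (hu : Unt X) {A B : Set X} (hAB : ∀ x ∈ A, ∀ y ∈ B, x < y) (hc : ∀ x, x ∈ A ∨ x ∈ B)
    {a0 : X} (ha0 : a0 ∈ A) : Embeds X A ∨ Embeds X ↥(insert a0 B) := by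
  classical
  refine hu _ _ (embeds_coe _) (embeds_coe _) ?_
  have hB : ∀ x, x ∉ A → x ∈ B := fun x h => (hc x).resolve_left h
  refine ⟨fun x => if h : x ∈ A then toLex (⟨a0, Or.inl rfl⟩, ⟨x, h⟩)
    else toLex (⟨x, Or.inr (hB x h)⟩, ⟨a0, ha0⟩), ?_⟩
  intro x y hxy
  by_cases hx : x ∈ A <;> by_cases hy : y ∈ A
  · simp only [hx, hy, dif_pos]
    rw [Prod.Lex.toLex_lt_toLex]
    exact Or.inr ⟨rfl, hxy⟩
  · simp only [hx, hy, dif_pos, dif_neg, not_false_eq_true]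
    rw [Prod.Lex.toLex_lt_toLex]
    exact Or.inl (hAB a0 ha0 y (hB y hy))
  · exact absurd (hAB y hy x (hB x hx)) (not_lt.2 hxy.le)
  · simp only [hx, hy, dif_neg, not_false_eq_true]
    rw [Prod.Lex.toLex_lt_toLex]
    exact Or.inl hxy

theorem cutB (hu : Unt X) {A B : Set X} (hAB : ∀ x ∈ A, ∀ y ∈ B, x < y) (hc : ∀ x, x ∈ A ∨ x ∈ B)
    {b0 : X} (hb0 : b0 ∈ B) : Embeds X B ∨ Embeds X ↥(insert b0 A) := by
  classical
  refine hu _ _ (embeds_coe _) (embeds_coe _) ?_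
  have hA : ∀ x, x ∉ B → x ∈ A := fun x h => (hc x).resolve_right h
  refine ⟨fun x => if h : x ∈ B then toLex (⟨b0, Or.inl rfl⟩, ⟨x, h⟩)
    else toLex (⟨x, Or.inr (hA x h)⟩, ⟨b0, hb0⟩), ?_⟩
  intro x y hxy
  by_cases hx : x ∈ B <;> by_cases hy : y ∈ B
  · simp only [hx, hy, dif_pos]
    rw [Prod.Lex.toLex_lt_toLex]
    exact Or.inr ⟨rfl, hxy⟩
  · exact absurd (hAB y (hA y hy) x hx) (not_lt.2 hxy.le)
  · simp only [hx, hy, dif_pos, dif_neg, not_false_eq_true]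
    rw [Prod.Lex.toLex_lt_toLex]
    exact Or.inl (hAB x (hA x hx) b0 hb0)
  · simp only [hx, hy, dif_neg, not_false_eq_true]
    rw [Prod.Lex.toLex_lt_toLex]
    exact Or.inl hxy

theorem cut1 (hu : Unt X) (h2 : ¬ Nonempty (X ≃ Fin 2)) {A B : Set X}
    (hAB : ∀ x ∈ A, ∀ y ∈ B, x < y) (hc : ∀ x, x ∈ A ∨ x ∈ B) (hA : A.Nonempty) (hB : B.Nonempty) :
    Embeds X A ∨ Embeds X B := by
  obtain ⟨a0, ha0⟩ := hA
  obtain ⟨b0, hb0⟩ := hB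
  rcases cutA hu hAB hc ha0 with h | h
  · exact Or.inl h
  rw [embeds_iff (X := X) (S := B)]
  obtain ⟨f, hf, hfm⟩ := embeds_iff.1 h
  by_cases hx0 : ∃ x0, f x0 = a0
  · obtain ⟨x0, hx0⟩ := hx0
    have hmin : ∀ x, x0 ≤ x := by
      intro x
      rw [← hf.le_iff_le, hx0]
      rcases hfm x with h | h
      · exact h.ge
      · exact (hAB a0 ha0 _ h).le
    have hb : b0 ∈ Set.Ioi x0 := lt_of_le_of_lt (hmin a0) (hAB a0 ha0 b0 hb0)
    rcases cutB hu (A := {x0}) (B := Set.Ioi x0) (by rintro _ rfl y hy; exact hy)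
      (fun x => (hmin x).eq_or_lt.imp (fun h => h.symm) id) hb with h' | h'
    · obtain ⟨g, hg, hgm⟩ := embeds_iff.1 h'
      right
      refine ⟨f ∘ g, hf.comp hg, fun x => ?_⟩
      rcases hfm (g x) with h | h
      · have := hf (hgm x)
        rw [hx0, h] at this
        exact absurd this (lt_irrefl _)
      · exact h
    · exfalso
      apply h2
      obtain ⟨g, hg⟩ := h'
      have : Finite X := Finite.of_injective g hg.injective
      have h3 : Nat.card X ≤ 2 := by
        refine (Nat.card_le_card_of_injective g hg.injective).trans ?_
        rw [Nat.card_coe_set_eq]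
        exact (Set.ncard_insert_le _ _).trans (by rw [Set.ncard_singleton])
      have h4 : 2 ≤ Nat.card X := by
        have : Nontrivial X := ⟨x0, b0, ne_of_lt hb⟩
        exact Finite.one_lt_card
      exact ⟨Finite.equivFinOfCardEq (le_antisymm h3 h4)⟩
  · right
    refine ⟨f, hf, fun x => ?_⟩
    rcases hfm x with h | h
    · exact absurd ⟨x, h⟩ hx0
    · exact h

theorem cut (hu : Unt X) (h2 : ¬ Nonempty (X ≃ Fin 2)) {L U : Set X}
    (hLU : ∀ x ∈ L, ∀ y ∈ U, x < y) (h : Embeds X ↥(L ∪ U)) :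
    Embeds X L ∨ Embeds X U := by
  obtain ⟨f, hf, hfm⟩ := embeds_iff.1 h
  have key : ∀ V : Set X, Embeds X ↥(f ⁻¹' V) → Embeds X V := by
    intro V h
    obtain ⟨g, hg, hgm⟩ := embeds_iff.1 h
    exact embeds_iff.2 ⟨f ∘ g, hf.comp hg, fun x => hgm x⟩
  by_cases hA : (f ⁻¹' L).Nonempty
  · by_cases hB : (f ⁻¹' U).Nonempty
    · refine (cut1 hu h2 (A := f ⁻¹' L) (B := f ⁻¹' U) ?_ hfm hA hB).imp (key L) (key U)
      intro x hx y hy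
      exact hf.lt_iff_lt.1 (hLU _ hx _ hy)
    · left
      exact embeds_iff.2 ⟨f, hf, fun x => (hfm x).resolve_right fun h => hB ⟨x, h⟩⟩
  · right
    exact embeds_iff.2 ⟨f, hf, fun x => (hfm x).resolve_left fun h => hA ⟨x, h⟩⟩

theorem single_term [Nonempty X] [Countable X] (hu : Unt X) (h2 : ¬ Nonempty (X ≃ Fin 2))
    (hs : Scat X) : ∃ t, Emb t (Set.univ : Set X) ∧ ∀ W : Set X, Emb t W → Embeds X W := by
  have key : ∀ l (S : Set X), FS l S → Embeds X S → ∃ t, ∃ V : Set X, Emb t V ∧ Bd t V ∧ Embeds X V := by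
    intro l S h
    induction h with
    | nil =>
      rintro ⟨f, _⟩
      exact (Set.notMem_empty _ (f (Classical.arbitrary X)).2).elim
    | @cons l t L U h1 h2' h3 h4 ih =>
      intro h
      rcases cut hu h2 h4 h with h | h
      · exact ih h
      · exact ⟨t, U, h2', h3, h⟩
  obtain ⟨l, hl⟩ := decomp hs (Set.univ : Set X)
  obtain ⟨t, V, h1, h2, h3⟩ := key l _ hl ⟨fun x => ⟨x, trivial⟩, fun _ _ h => h⟩
  exact ⟨t, h1.mono (Set.subset_univ _), fun W hW => Embeds.trans' h3 (embS_iff.1 (h2 W hW))⟩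

theorem Unt.equiv (hu : Unt X) {V : Type u} [LinearOrder V] (h1 : Embeds X V) (h2 : Embeds V X) :
    Unt V := by
  intro A B _ _ hA hB h
  exact (hu A B (Embeds.trans' hA h2) (Embeds.trans' hB h2) (Embeds.trans' h1 h)).imp
    (Embeds.trans' h2) (Embeds.trans' h2)

theorem embeds_dual {A : Type u} {B : Type v} [LinearOrder A] [LinearOrder B] (h : Embeds A B) :
    Embeds Aᵒᵈ Bᵒᵈ := by
  obtain ⟨f, hf⟩ := h
  exact ⟨fun x => OrderDual.toDual (f (OrderDual.ofDual x)), fun x y h => hf h⟩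

theorem Unt.dual (hu : Unt X) : Unt Xᵒᵈ := by
  intro A B _ _ hA hB h
  have h' : Embeds X (Bᵒᵈ ×ₗ Aᵒᵈ) := by
    obtain ⟨f, hf⟩ := h
    refine ⟨fun x => toLex (OrderDual.toDual (ofLex (f (OrderDual.toDual x))).1,
      OrderDual.toDual (ofLex (f (OrderDual.toDual x))).2), ?_⟩
    intro x y hxy
    have h1 : f (OrderDual.toDual y) < f (OrderDual.toDual x) := hf hxy
    rw [Prod.Lex.lt_iff] at h1
    rw [Prod.Lex.toLex_lt_toLex]
    rcases h1 with h1 | ⟨h1, h2⟩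
    · exact Or.inl h1
    · exact Or.inr ⟨congrArg OrderDual.toDual h1.symm, h2⟩
  rcases hu Aᵒᵈ Bᵒᵈ (embeds_dual hA) (embeds_dual hB) h' with h | h
  · exact Or.inl (embeds_dual h)
  · exact Or.inr (embeds_dual h)

theorem Scat.of_embeds (hs : Scat X) {V : Type v} [LinearOrder V] (h : Embeds V X) : Scat V := by
  obtain ⟨f, hf⟩ := h
  intro D hD hd
  refine hs (f '' D) (hD.image hf.injective) ?_
  rintro _ ⟨x, hx, rfl⟩ _ ⟨y, hy, rfl⟩ hxy
  obtain ⟨z, hz, h1, h2⟩ := hd x hx y hy (hf.lt_iff_lt.1 hxy)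
  exact ⟨f z, ⟨z, hz, rfl⟩, hf h1, hf h2⟩

theorem Scat.dual (hs : Scat X) : Scat Xᵒᵈ := by
  intro D hD hd
  refine hs (OrderDual.toDual ⁻¹' D) ?_ ?_
  · obtain ⟨x, hx, y, hy, hxy⟩ := hD
    exact ⟨OrderDual.ofDual x, hx, OrderDual.ofDual y, hy, fun h => hxy h⟩
  · intro x hx y hy hxy
    obtain ⟨z, hz, h1, h2⟩ := hd _ hy _ hx hxy
    exact ⟨OrderDual.ofDual z, hz, h2, h1⟩

theorem final [Countable X] (hu : Unt X) (h2 : ¬ Nonempty (X ≃ Fin 2))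
    (hmain : ∀ (Y : Type u) [LinearOrder Y] [Countable Y] [Nonempty Y], Unt Y → Scat Y →
      (∀ y : Y, Embeds Y (Set.Ioi y)) → ∀ S : Set Y, Embeds Y S ∨ Embeds Y ↥(Sᶜ)) :
    ∀ S : Set X, Embeds X S ∨ Embeds X ↥(Sᶜ) := by
  intro S
  rcases isEmpty_or_nonempty X with hX | hX
  · exact Or.inl ⟨fun x => isEmptyElim x, fun x => isEmptyElim x⟩
  by_cases hs : Scat X
  swap
  · exact qcase hs S
  obtain ⟨t, ht, hW⟩ := single_term hu h2 hs
  cases t with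
  | leaf =>
    by_cases hS : S.Nonempty
    · exact Or.inl (hW S hS)
    · right
      refine hW _ ?_
      rw [Set.not_nonempty_iff_eq_empty.1 hS, Set.compl_empty]
      exact Set.univ_nonempty
  | node b f =>
    obtain ⟨I, h1, h2, h3⟩ := ht
    let V : Set X := ⋃ n, I n
    have hV : Emb (node b f) V := ⟨I, fun n => Set.subset_iUnion I n, h2, h3⟩
    have hXV := hW V hV
    have hVX := embeds_coe V
    have hVu := hu.equiv hXV hVX
    have hVs := hs.of_embeds hVX
    have hVne : Nonempty V := hV.nonempty.to_subtype
    have htail : ∀ v : V, Embeds V {w : V | ltb b v w} := by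
      rintro ⟨v, hv⟩
      obtain ⟨n, hn⟩ := Set.mem_iUnion.1 hv
      have hV' : Emb (node b f) (⋃ k, I (n + 1 + k)) := by
        refine ⟨fun k => I (n + 1 + k), fun k => Set.subset_iUnion (fun k => I (n + 1 + k)) k,
          fun i j hij => h2 _ _ (by omega), ?_⟩
        intro m K
        obtain ⟨k, hk, hk'⟩ := h3 m (n + 1 + K)
        refine ⟨k - (n + 1), by omega, ?_⟩
        have : n + 1 + (k - (n + 1)) = k := by omega
        beta_reduce
        rw [this]; exact hk'
      obtain ⟨g, hg, hgm⟩ := embeds_iff.1 (Embeds.trans' hVX (hW _ hV'))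
      rw [embeds_iff]
      have hmem : ∀ x, g x ∈ V := by
        intro x
        obtain ⟨k, hk⟩ := Set.mem_iUnion.1 (hgm x)
        exact Set.mem_iUnion.2 ⟨_, hk⟩
      refine ⟨fun x => ⟨g x, hmem x⟩, fun _ _ h => hg h, fun x => ?_⟩
      obtain ⟨k, hk⟩ := Set.mem_iUnion.1 (hgm x)
      have h4 := h2 n (n + 1 + k) (by omega) v hn _ hk
      cases b
      · exact h4
      · exact h4
    have hconc : ∀ T : Set V, Embeds V T → Embeds X ↥(Subtype.val '' T) := by
      intro T hT
      refine Embeds.trans' hXV (Embeds.trans' hT ?_)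
      exact ⟨fun x => ⟨x.1.1, x.1, x.2, rfl⟩, fun _ _ h => h⟩
    have hfin : (Embeds V ↥(Subtype.val ⁻¹' S : Set V) ∨ Embeds V ↥((Subtype.val ⁻¹' S : Set V)ᶜ)) →
        Embeds X S ∨ Embeds X ↥(Sᶜ) := by
      rintro (h | h)
      · left
        refine Embeds.trans' (hconc _ h) (embeds_sub ?_)
        rintro _ ⟨x, hx, rfl⟩; exact hx
      · right
        refine Embeds.trans' (hconc _ h) (embeds_sub ?_)
        rintro _ ⟨x, hx, rfl⟩; exact hx
    apply hfin
    cases b with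
    | true => exact hmain V hVu hVs htail _
    | false =>
      have : Countable (↥V)ᵒᵈ := inferInstanceAs (Countable ↥V)
      have : Nonempty (↥V)ᵒᵈ := inferInstanceAs (Nonempty ↥V)
      rcases hmain (V)ᵒᵈ hVu.dual hVs.dual (fun y => by
        obtain ⟨g, hg⟩ := htail (OrderDual.ofDual y)
        refine ⟨fun x => ⟨OrderDual.toDual (g (OrderDual.ofDual x)).1, (g (OrderDual.ofDual x)).2⟩, ?_⟩
        intro x y h
        exact hg (show OrderDual.ofDual y < OrderDual.ofDual x from h))
        (OrderDual.ofDual ⁻¹' (Subtype.val ⁻¹' S)) with h | h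
      · left
        obtain ⟨g, hg⟩ := h
        exact ⟨fun x => ⟨OrderDual.ofDual (g (OrderDual.toDual x)).1, (g (OrderDual.toDual x)).2⟩,
          fun x y h => hg (show OrderDual.toDual y < OrderDual.toDual x from h)⟩
      · right
        obtain ⟨g, hg⟩ := h
        exact ⟨fun x => ⟨OrderDual.ofDual (g (OrderDual.toDual x)).1, (g (OrderDual.toDual x)).2⟩,
          fun x y h => hg (show OrderDual.toDual y < OrderDual.toDual x from h)⟩
end
end Tm

namespace Tm
section

theorem Unt.het {X : Type u} [LinearOrder X] (hu : Unt X) {A : Type v} {B : Type w}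
    [LinearOrder A] [LinearOrder B] (hA : Embeds A X) (hB : Embeds B X)
    (h : Embeds X (B ×ₗ A)) : Embeds X A ∨ Embeds X B := by
  obtain ⟨p, hp⟩ := hA
  obtain ⟨q, hq⟩ := hB
  obtain ⟨f, hf⟩ := h
  have back : ∀ {C : Type _} [LinearOrder C] (r : C → X), StrictMono r → Embeds ↥(Set.range r) C := by
    intro C _ r hr
    refine ⟨fun x => x.2.choose, fun x y hxy => ?_⟩
    rw [← hr.lt_iff_lt, x.2.choose_spec, y.2.choose_spec]
    exact hxy
  have back' : ∀ {C : Type _} [LinearOrder C] (r : C → X), StrictMono r → Embeds ↥(Set.range r) C := by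
    intro C _ r hr
    refine ⟨fun x => x.2.choose, fun x y hxy => ?_⟩
    rw [← hr.lt_iff_lt, x.2.choose_spec, y.2.choose_spec]
    exact hxy
  have := hu (Set.range p) (Set.range q) (embeds_coe _) (embeds_coe _)
    ⟨fun x => toLex (⟨q (ofLex (f x)).1, _, rfl⟩, ⟨p (ofLex (f x)).2, _, rfl⟩), ?_⟩
  · exact this.imp (fun h => Embeds.trans' h (back p hp)) (fun h => Embeds.trans' h (back' q hq))
  · intro x y hxy
    have h1 := hf hxy
    rw [Prod.Lex.lt_iff] at h1
    rw [Prod.Lex.toLex_lt_toLex]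
    rcases h1 with h1 | ⟨h1, h2⟩
    · exact Or.inl (hq h1)
    · exact Or.inr ⟨by rw [h1], hp h2⟩

variable {X : Type u} [LinearOrder X]

/-- Shifting copies of `X` past any given bounds. -/
theorem shifts [Nonempty X] (hT : ∀ x : X, Embeds X (Set.Ioi x)) (y : ℕ → X) :
    ∃ φ : ℕ → X → X, (∀ n, StrictMono (φ n)) ∧
      ∀ n m, n < m → ∀ x x', x < y n → φ n x < φ m x' := by
  have hT' := fun x => embeds_iff.1 (hT x)
  choose τ h1 h2 using hT'
  let c : ℕ → X := fun n => Nat.rec (Classical.arbitrary X) (fun n p => τ p (y n)) n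
  have hc : ∀ n, c (n+1) = τ (c n) (y n) := fun n => rfl
  have hcm : Monotone c := monotone_nat_of_le_succ fun n => by rw [hc]; exact (h2 _ _).le
  refine ⟨fun n => τ (c n), fun n => h1 _, ?_⟩
  intro n m hnm x x' hx
  calc τ (c n) x < τ (c n) (y n) := h1 _ hx
    _ = c (n+1) := (hc n).symm
    _ ≤ c m := hcm hnm
    _ < _ := h2 _ _

theorem bounded_far (hT : ∀ x : X, Embeds X (Set.Ioi x)) {a : Tm}
    (ha : ∃ y : X, Emb a (Set.Iio y)) (y : X) : ∃ z, Emb a (Set.Ioo y z) := by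
  obtain ⟨y0, h0⟩ := ha
  obtain ⟨f, hf, hfm⟩ := embeds_iff.1 (hT y)
  refine ⟨f y0, (h0.image (hf.strictMonoOn _)).mono ?_⟩
  rintro _ ⟨x, hx, rfl⟩
  exact ⟨hfm x, hf hx⟩

def rr (a : Tm) (x y : X) : Prop := ¬ Emb a (Set.Ico x y) ∧ ¬ Emb a (Set.Ico y x)

theorem not_emb_trans {a : Tm} {x y z : X} (h1 : ¬ Emb a (Set.Ico x y)) (h2 : ¬ Emb a (Set.Ico y z)) :
    ¬ Emb a (Set.Ico x z) := by
  intro h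
  rcases h.split (L := Set.Ico x y) (U := Set.Ico y z) (fun w hw => (lt_or_ge w y).imp (fun h => ⟨hw.1, h⟩) (fun h => ⟨h, hw.2⟩))
    (fun s hs t ht => hs.2.trans_le ht.1) with h | h
  · exact h1 h
  · exact h2 h

theorem not_emb_of_le {a : Tm} {x y : X} (h : y ≤ x) : ¬ Emb a (Set.Ico x y) := by
  intro h'
  obtain ⟨w, hw⟩ := h'.nonempty
  exact absurd (hw.1.trans_lt hw.2) (not_lt.2 h)

theorem rr.refl (a : Tm) (x : X) : rr a x x := ⟨not_emb_of_le le_rfl, not_emb_of_le le_rfl⟩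
theorem rr.symm {a : Tm} {x y : X} (h : rr a x y) : rr a y x := ⟨h.2, h.1⟩
theorem rr.trans {a : Tm} {x y z : X} (h : rr a x y) (h' : rr a y z) : rr a x z :=
  ⟨not_emb_trans h.1 h'.1, not_emb_trans h'.2 h.2⟩

variable (X) in
def rset (a : Tm) : Setoid X := ⟨rr a, rr.refl a, rr.symm, rr.trans⟩

noncomputable def rep (a : Tm) (x : X) : X := (Quotient.mk (rset X a) x).out

theorem rep_rr (a : Tm) (x : X) : rr a (rep a x) x :=
  Quotient.exact (s := rset X a) (Quotient.out_eq (Quotient.mk (rset X a) x))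

theorem rep_eq {a : Tm} {x y : X} (h : rr a x y) : rep a x = rep a y := by
  have : Quotient.mk (rset X a) x = Quotient.mk (rset X a) y := Quotient.sound h
  unfold rep
  rw [this]

theorem rep_lt {a : Tm} {x y : X} (hxy : x ≤ y) (h : ¬ rr a x y) : rep a x < rep a y := by
  by_contra hc
  push Not at hc
  apply h
  refine ⟨?_, not_emb_of_le hxy⟩
  exact not_emb_trans (rep_rr a x).2 (not_emb_trans (not_emb_of_le hc) (rep_rr a y).1)

theorem rep_spaced {a : Tm} {x y : X} (h : rep a x < rep a y) : Emb a (Set.Ico (rep a x) (rep a y)) := by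
  by_contra hc
  have h1 : rr a (rep a x) (rep a y) := ⟨hc, not_emb_of_le h.le⟩
  have h2 : rr a x y := ((rep_rr a x).symm.trans h1).trans (rep_rr a y)
  rw [rep_eq h2] at h
  exact lt_irrefl _ h

theorem emb_lt_bound {Y : Type v} [LinearOrder Y] {a : Tm} (ι : Y → ℕ) (N : ℕ) {S : Set Y}
    (hι : ∀ x ∈ S, ∀ y ∈ S, x ≤ y → ι x ≤ ι y)
    (h : Emb a S) (hS : ∀ x ∈ S, ι x ≤ N) : ∃ n, Emb a {x | x ∈ S ∧ ι x = n} := by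
  induction N generalizing S with
  | zero => exact ⟨0, h.mono fun x hx => ⟨hx, Nat.le_zero.1 (hS x hx)⟩⟩
  | succ N ih =>
    have hsp := h.split (L := {x | x ∈ S ∧ ι x ≤ N}) (U := {x | x ∈ S ∧ ι x = N+1}) ?_ ?_
    rcases hsp with h | h
    · obtain ⟨n, hn⟩ := ih (S := {x | x ∈ S ∧ ι x ≤ N})
        (fun x hx y hy => hι x hx.1 y hy.1) h (fun x hx => hx.2)
      exact ⟨n, hn.mono fun x hx => ⟨hx.1.1, hx.2⟩⟩
    · exact ⟨_, h⟩
    · intro x hx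
      rcases Nat.lt_or_ge N (ι x) with h | h
      · exact Or.inr ⟨hx, le_antisymm (hS x hx) h⟩
      · exact Or.inl ⟨hx, h⟩
    · clear h
      intro x hx y hy
      by_contra hc
      have := hι y hy.1 x hx.1 (not_lt.1 hc)
      have h1 := hx.2
      have h2 := hy.2
      omega

theorem spaced_aux [Countable X] [Nonempty X] (hu : Unt X) (hT : ∀ x : X, Embeds X (Set.Ioi x))
    {a : Tm} (ha : ∃ y : X, Emb a (Set.Iio y)) {I : Type} [LinearOrder I] (hI : Embeds I X)
    (hXI : ¬ Embeds X I) (i : X → I) (hi : ∀ x y, x ≤ y → rr a x y → i x ≤ i y)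
    (hfib : ∀ x0, ¬ Emb a {x | rr a x x0 ∧ i x = i x0}) :
    ∃ g : X → X, StrictMono g ∧ ∀ x y, x < y → Emb a (Set.Ico (g x) (g y)) := by
  classical
  obtain ⟨e, he⟩ := exists_surjective_nat X
  have hex : ∀ x, ∃ m, rr a (e m) x ∧ i (e m) = i x := by
    intro x
    obtain ⟨m, rfl⟩ := he x
    exact ⟨m, rr.refl a _, rfl⟩
  let ν : X → ℕ := fun x => Nat.find (hex x)
  have hν : ∀ x, rr a (e (ν x)) x ∧ i (e (ν x)) = i x := fun x => Nat.find_spec (hex x)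
  have hνe : ∀ x y, rr a x y → i x = i y → ν x = ν y := by
    intro x y h1 h2
    refine Nat.find_congr' ?_
    intro m
    constructor
    · rintro ⟨h3, h4⟩; exact ⟨h3.trans h1, h4.trans h2⟩
    · rintro ⟨h3, h4⟩; exact ⟨h3.trans h1.symm, h4.trans h2.symm⟩
  have hνe' : ∀ x y, ν x = ν y → rr a x y ∧ i x = i y := by
    intro x y h
    have h1 := hν x
    have h2 := hν y
    rw [h] at h1
    exact ⟨h1.1.symm.trans h2.1, h1.2.symm.trans h2.2⟩
  let R : Set X := Set.range (rep (X := X) a)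
  let k : X → R ×ₗ I := fun x => toLex (⟨rep a x, x, rfl⟩, i x)
  have kmono : ∀ x y, x < y → ¬ (rr a x y ∧ i x = i y) → k x < k y := by
    intro x y hxy h
    rw [Prod.Lex.toLex_lt_toLex]
    by_cases hr : rr a x y
    · right
      refine ⟨Subtype.ext (rep_eq hr), lt_of_le_of_ne (hi x y hxy.le hr) fun h' => h ⟨hr, h'⟩⟩
    · left
      exact rep_lt hxy.le hr
  have keq : ∀ x y, rr a x y → i x = i y → k x = k y := by
    intro x y h1 h2
    simp only [k]
    rw [h2]
    congr 2
    exact Subtype.ext (rep_eq h1)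
  let B : Set X := Set.range fun x => e (ν x)
  let A : Set (ℕ ×ₗ X) := {p | (ofLex p).1 = ν (ofLex p).2}
  have hbnd : ∀ n, ∃ z, ∀ x, ν x = n → x < z := by
    intro n
    obtain ⟨z, hz⟩ := bounded_far hT ha (e n)
    refine ⟨z, fun x hx => ?_⟩
    subst hx
    by_contra hc
    refine (hν x).1.1 (hz.mono fun w hw => ⟨hw.1.le, hw.2.trans_le (not_lt.1 hc)⟩)
  choose y hy using hbnd
  obtain ⟨φ, hφ1, hφ2⟩ := shifts hT y
  have hAX : Embeds A X := by
    refine ⟨fun p => φ (ofLex p.1).1 (ofLex p.1).2, ?_⟩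
    rintro ⟨p, hp⟩ ⟨q, hq⟩ hpq
    have hpq : p < q := hpq
    rw [Prod.Lex.lt_iff] at hpq
    rcases hpq with h | ⟨h, h'⟩
    · exact hφ2 _ _ h _ _ (hy _ _ hp.symm)
    · dsimp only
      rw [h]
      exact hφ1 _ h'
  have hBX : Embeds X (B ×ₗ A) := by
    refine ⟨fun x => toLex (⟨e (ν x), x, rfl⟩, ⟨toLex (ν x, x), rfl⟩), ?_⟩
    intro x y hxy
    rw [Prod.Lex.toLex_lt_toLex]
    by_cases h : rr a x y ∧ i x = i y
    · right
      have h1 := hνe x y h.1 h.2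
      refine ⟨Subtype.ext (congrArg e h1), ?_⟩
      show toLex (ν x, x) < toLex (ν y, y)
      rw [Prod.Lex.toLex_lt_toLex]
      exact Or.inr ⟨h1, hxy⟩
    · left
      have h1 := kmono x y hxy h
      show e (ν x) < e (ν y)
      by_contra hc
      have hx := hν x
      have hy := hν y
      rw [← keq _ _ hx.1 hx.2, ← keq _ _ hy.1 hy.2] at h1
      rcases (not_lt.1 hc).eq_or_lt with h2 | h2
      · rw [h2] at h1; exact lt_irrefl _ h1
      · by_cases h3 : rr a (e (ν y)) (e (ν x)) ∧ i (e (ν y)) = i (e (ν x))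
        · rw [keq _ _ h3.1 h3.2] at h1; exact lt_irrefl _ h1
        · exact lt_asymm h1 (kmono _ _ h2 h3)
  have hXA : ¬ Embeds X A := by
    rintro ⟨h, hh⟩
    obtain ⟨y0, h0⟩ := ha
    have h1 := h0.image (hh.strictMonoOn _)
    obtain ⟨n, hn⟩ := emb_lt_bound (fun p : A => (ofLex p.1).1) (ofLex (h y0).1).1
      (S := h '' Set.Iio y0) (by
        rintro p _ q _ hpq
        exact Prod.Lex.monotone_fst _ _ hpq) h1 (by
        rintro _ ⟨x, hx, rfl⟩
        exact Prod.Lex.monotone_fst _ _ (hh hx).le)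
    have h2 := hn.image (g := fun p : A => (ofLex p.1).2) (by
      rintro ⟨p, hp⟩ ⟨_, hp'⟩ ⟨q, hq⟩ ⟨_, hq'⟩ hpq
      have hpq : p < q := hpq
      rw [Prod.Lex.lt_iff] at hpq
      rcases hpq with h | ⟨h, h'⟩
      · dsimp only at hp' hq'
        omega
      · exact h')
    obtain ⟨x0, ⟨p0, hp0, rfl⟩⟩ := h2.nonempty
    refine hfib (ofLex p0.1).2 (h2.mono ?_)
    rintro _ ⟨p, hp, rfl⟩
    apply hνe'
    have e1 : (ofLex p.1).1 = ν (ofLex p.1).2 := p.2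
    have e2 : (ofLex p0.1).1 = ν (ofLex p0.1).2 := p0.2
    rw [← e1, ← e2]
    exact hp.2.trans hp0.2.symm
  have hXB := (hu.het hAX (embeds_coe B) hBX).resolve_left hXA
  have hBk : Embeds B (R ×ₗ I) := by
    refine ⟨fun x => k x, ?_⟩
    rintro ⟨_, x, rfl⟩ ⟨_, y, rfl⟩ hxy
    have hxy : e (ν x) < e (ν y) := hxy
    refine kmono _ _ hxy ?_
    rintro ⟨h1, h2⟩
    have hx := hν x
    have hy := hν y
    have := hνe x y (hx.1.symm.trans (h1.trans hy.1)) (hx.2.symm.trans (h2.trans hy.2))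
    rw [this] at hxy
    exact lt_irrefl _ hxy
  have hXR := (hu.het hI (embeds_coe R) (Embeds.trans' hXB hBk)).resolve_left hXI
  obtain ⟨g, hg⟩ := hXR
  refine ⟨fun x => g x, fun x y h => hg h, fun x y hxy => ?_⟩
  have h1 := hg hxy
  obtain ⟨x', hx'⟩ := (g x).2
  obtain ⟨y', hy'⟩ := (g y).2
  have h1 : (g x).1 < (g y).1 := h1
  show Emb a (Set.Ico (g x).1 (g y).1)
  rw [← hx', ← hy'] at h1 ⊢
  exact rep_spaced h1

theorem frequent_points {f : ℕ → Tm} {I : ℕ → Set X}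
    (h3 : ∀ m K, ∃ k, K ≤ k ∧ Emb (f m) (I k)) (K : ℕ) : ∃ k, K ≤ k ∧ (I k).Nonempty := by
  obtain ⟨k, hk, hk'⟩ := h3 0 K
  exact ⟨k, hk, hk'.nonempty⟩

theorem emb_tail {b : Bool} {f : ℕ → Tm} {I : ℕ → Set X}
    (h2 : ∀ m n, m < n → ∀ x ∈ I m, ∀ y ∈ I n, ltb b x y)
    (h3 : ∀ m K, ∃ k, K ≤ k ∧ Emb (f m) (I k)) {V : Set X} {k0 : ℕ}
    (hV : ∀ n, k0 < n → I n ⊆ V) : Emb (node b f) V := by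
  refine ⟨fun n => I (n + k0 + 1), fun n => hV _ (by omega), fun m n hmn => h2 _ _ (by omega), ?_⟩
  intro m K
  obtain ⟨k, hk, hk'⟩ := h3 m (K + k0 + 1)
  refine ⟨k - k0 - 1, by omega, ?_⟩
  have : k - k0 - 1 + k0 + 1 = k := by omega
  beta_reduce
  rw [this]; exact hk'

theorem noMax (hT : ∀ x : X, Embeds X (Set.Ioi x)) : NoMaxOrder X := ⟨fun x => by
  obtain ⟨f, _, h⟩ := embeds_iff.1 (hT x)
  exact ⟨f x, h x⟩⟩

theorem spaced [Countable X] [Nonempty X] (hu : Unt X) (hT : ∀ x : X, Embeds X (Set.Ioi x))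
    (hN : ¬ Embeds X ℕ) {a : Tm} (ha : ∃ y : X, Emb a (Set.Iio y)) :
    ∃ g : X → X, StrictMono g ∧ ∀ x y, x < y → Emb a (Set.Ico (g x) (g y)) := by
  classical
  have := noMax hT
  obtain ⟨e, he⟩ := exists_surjective_nat X
  cases a with
  | leaf => exact ⟨id, strictMono_id, fun x y h => ⟨x, le_rfl, h⟩⟩
  | node b f =>
    cases b with
    | true =>
      have hex : ∀ x, ∃ n, x ≤ e n ∧ rr (node true f) x (e n) := by
        intro x
        obtain ⟨n, rfl⟩ := he x
        exact ⟨n, le_rfl, rr.refl _ _⟩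
      refine spaced_aux hu hT ha (I := ℕ) ?_ hN (fun x => Nat.find (hex x)) ?_ ?_
      · obtain ⟨s, hs⟩ := Nat.exists_strictMono X
        exact ⟨s, hs⟩
      · intro x y hxy h
        refine Nat.find_min' _ ?_
        obtain ⟨h1, h2⟩ := Nat.find_spec (hex y)
        exact ⟨hxy.trans h1, h.trans h2⟩
      · rintro x0 ⟨I, h1, h2, h3⟩
        obtain ⟨k0, _, x, hx⟩ := frequent_points h3 0
        have hxi : Nat.find (hex x) = Nat.find (hex x0) := (h1 _ hx).2
        obtain ⟨h4, h5⟩ := Nat.find_spec (hex x)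
        rw [hxi] at h4 h5
        refine h5.1 (emb_tail h2 h3 (k0 := k0) ?_)
        intro n hn z hz
        refine ⟨(h2 k0 n hn x hx z hz : x < z).le, ?_⟩
        obtain ⟨k1, hk1, w, hw⟩ := frequent_points h3 (n+1)
        refine lt_of_lt_of_le (h2 n k1 hk1 z hz w hw : z < w) ?_
        have hwi : Nat.find (hex w) = Nat.find (hex x0) := (h1 _ hw).2
        have h6 := (Nat.find_spec (hex w)).1
        rw [hwi] at h6
        exact h6
    | false =>
      have hex : ∀ x, ∃ n, e n ≤ x ∧ rr (node false f) x (e n) := by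
        intro x
        obtain ⟨n, rfl⟩ := he x
        exact ⟨n, le_rfl, rr.refl _ _⟩
      refine spaced_aux hu hT ha (I := ℕᵒᵈ) ?_ ?_ (fun x => OrderDual.toDual (Nat.find (hex x))) ?_ ?_
      · obtain ⟨y, I, h1, h2, h3⟩ := ha
        obtain ⟨φ, hφ, hφ'⟩ := Filter.extraction_of_frequently_atTop
          (P := fun k => (I k).Nonempty) (Filter.frequently_atTop.2
            (frequent_points h3))
        choose p hp using hφ'
        refine ⟨fun n => p (OrderDual.ofDual n), ?_⟩
        intro m n hmn
        exact h2 _ _ (hφ (show OrderDual.ofDual n < OrderDual.ofDual m from hmn)) _ (hp _) _ (hp _)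
      · rintro ⟨h, hh⟩
        obtain ⟨s, hs⟩ := Nat.exists_strictMono X
        have : StrictAnti fun n => OrderDual.ofDual (h (s n)) := fun m n hmn => hh (hs hmn)
        exact (RelEmbedding.not_wellFounded (RelEmbedding.natGT _ fun n => this (Nat.lt_succ_self n))) wellFounded_lt
      · intro x y hxy h
        show Nat.find (hex y) ≤ Nat.find (hex x)
        refine Nat.find_min' _ ?_
        obtain ⟨h1, h2⟩ := Nat.find_spec (hex x)
        exact ⟨h1.trans hxy, h.symm.trans h2⟩
      · rintro x0 ⟨I, h1, h2, h3⟩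
        obtain ⟨k0, _, x, hx⟩ := frequent_points h3 0
        have hxi : Nat.find (hex x) = Nat.find (hex x0) := (h1 _ hx).2
        obtain ⟨h4, h5⟩ := Nat.find_spec (hex x)
        rw [hxi] at h4 h5
        refine h5.2 (emb_tail h2 h3 (k0 := k0) ?_)
        intro n hn z hz
        refine ⟨?_, (h2 k0 n hn x hx z hz : z < x)⟩
        have hwi : Nat.find (hex z) = Nat.find (hex x0) := (h1 _ hz).2
        have h6 := (Nat.find_spec (hex z)).1
        rw [hwi] at h6
        exact h6

def subst : Tm → Tm → Tm
  | leaf, a => a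
  | node b f, a => node b fun n => subst (f n) a

theorem emb_subst {a : Tm} {g : X → X} (hg : StrictMono g)
    (hga : ∀ x y, x < y → Emb a (Set.Ico (g x) (g y))) (b : Tm) {S : Set X} {y : X}
    (hS : ∀ s ∈ S, s < y) (h : Emb b S) : Emb (subst b a) {z | ∃ s ∈ S, g s ≤ z ∧ z < g y} := by
  induction b generalizing S y with
  | leaf =>
    obtain ⟨s, hs⟩ := h
    exact (hga s y (hS s hs)).mono fun z hz => ⟨s, hs, hz.1, hz.2⟩
  | node b f ih =>
    obtain ⟨I, h1, h2, h3⟩ := h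
    obtain ⟨φ, hφ, hφ'⟩ := Filter.extraction_forall_of_frequently
      (P := fun j k => Emb (f ((j/2).unpair.1)) (I k)) (fun j => Filter.frequently_atTop.2 (h3 _))
    have hne : ∀ j, ∃ p, p ∈ I (φ j) := fun j => (hφ' j).nonempty
    choose p hp using hne
    cases b with
    | true =>
      refine ⟨fun n => {z | ∃ s ∈ I (φ (2*n)), g s ≤ z ∧ z < g (p (2*n+1))}, ?_, ?_, ?_⟩
      · rintro n z ⟨s, hs, h4, h5⟩
        exact ⟨s, h1 _ hs, h4, h5.trans (hg (hS _ (h1 _ (hp _))))⟩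
      · rintro m n hmn x ⟨s, hs, h4, h5⟩ y ⟨t, ht, h6, h7⟩
        have : p (2*m+1) < t := h2 _ _ (hφ (show 2*m+1 < 2*n by omega)) _ (hp _) _ ht
        exact h5.trans ((hg this).trans_le h6)
      · intro m K
        refine ⟨Nat.pair m K, Nat.right_le_pair m K, ?_⟩
        have h4 := hφ' (2 * Nat.pair m K)
        have h5 : (2 * Nat.pair m K / 2).unpair.1 = m := by
          rw [Nat.mul_div_cancel_left _ (by omega), Nat.unpair_pair]
        rw [h5] at h4
        exact ih m (fun s hs => h2 _ _ (hφ (Nat.lt_succ_self _)) _ hs _ (hp _)) h4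
    | false =>
      refine ⟨fun n => {z | ∃ s ∈ I (φ (2*n+1)), g s ≤ z ∧ z < g (p (2*n))}, ?_, ?_, ?_⟩
      · rintro n z ⟨s, hs, h4, h5⟩
        exact ⟨s, h1 _ hs, h4, h5.trans (hg (hS _ (h1 _ (hp _))))⟩
      · rintro m n hmn x ⟨s, hs, h4, h5⟩ y ⟨t, ht, h6, h7⟩
        have : p (2*n) < s := h2 _ _ (hφ (show 2*m+1 < 2*n by omega)) _ hs _ (hp _)
        exact h7.trans ((hg this).trans_le h4)
      · intro m K
        refine ⟨Nat.pair m K, Nat.right_le_pair m K, ?_⟩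
        have h4 := hφ' (2 * Nat.pair m K + 1)
        have h5 : ((2 * Nat.pair m K + 1) / 2).unpair.1 = m := by
          rw [show (2 * Nat.pair m K + 1) / 2 = Nat.pair m K by omega, Nat.unpair_pair]
        rw [h5] at h4
        exact ih m (fun s hs => h2 _ _ (hφ (Nat.lt_succ_self _)) _ (hp _) _ hs) h4

theorem colour (b a : Tm) {Z S : Set X} (h : Emb (subst b a) Z) :
    Emb b (Z ∩ S) ∨ Emb a (Z ∩ Sᶜ) := by
  induction b generalizing Z with
  | leaf =>
    by_cases hc : (Z ∩ S).Nonempty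
    · exact Or.inl hc
    · right
      exact Emb.mono (t := a) h fun z hz => ⟨hz, fun hS => hc ⟨z, hz, hS⟩⟩
  | node b f ih =>
    obtain ⟨I, h1, h2, h3⟩ := h
    by_cases hc : ∃ k, Emb a (I k ∩ Sᶜ)
    · obtain ⟨k, hk⟩ := hc
      exact Or.inr (hk.mono (Set.inter_subset_inter_left _ (h1 k)))
    · push Not at hc
      left
      refine ⟨fun k => I k ∩ S, fun n => Set.inter_subset_inter_left _ (h1 n),
        fun m n hmn x hx y hy => h2 m n hmn x hx.1 y hy.1, fun m K => ?_⟩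
      obtain ⟨k, hk, hk'⟩ := h3 m K
      exact ⟨k, hk, (ih m hk').resolve_right (hc k)⟩

theorem gfit [Nonempty X] (hm : NoMaxOrder X) {S : Set X}
    (hS : ∀ a, (∃ y : X, Emb a (Set.Iio y)) → ∀ y, ∃ z, Emb a (S ∩ Set.Ioo y z))
    {l : List Tm} {F : Set X} (h : FS l F) {y0 : X} (hF : ∀ x ∈ F, x < y0) (y : X) :
    ∃ z, y < z ∧ EmbS F (S ∩ Set.Ioo y z) := by
  induction h generalizing y with
  | nil =>
    obtain ⟨z, hz⟩ := exists_gt y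
    exact ⟨z, hz, EmbS.empty _⟩
  | @cons l t L U h1 h2 h3 h4 ih =>
    obtain ⟨z1, hz1, e1⟩ := ih (fun x hx => hF x (Or.inl hx)) y
    obtain ⟨z2, hz2⟩ := hS t ⟨y0, h2.mono fun x hx => hF x (Or.inr hx)⟩ z1
    refine ⟨max z1 z2, hz1.trans_le (le_max_left _ _), (e1.union (h3 _ hz2) h4 ?_).mono subset_rfl ?_⟩
    · rintro x ⟨_, hx⟩ y ⟨_, hy⟩
      exact hx.2.trans hy.1
    · rintro x (⟨hx1, hx⟩ | ⟨hx1, hx⟩)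
      · exact ⟨hx1, hx.1, hx.2.trans_le (le_max_left _ _)⟩
      · exact ⟨hx1, hz1.trans hx.1, hx.2.trans_le (le_max_right _ _)⟩

theorem good_set [Countable X] [Nonempty X] (hs : Scat X) (hm : NoMaxOrder X) {S : Set X}
    (hS : ∀ a, (∃ y : X, Emb a (Set.Iio y)) → ∀ y, ∃ z, Emb a (S ∩ Set.Ioo y z)) :
    Embeds X S := by
  classical
  obtain ⟨e, he⟩ := exists_surjective_nat X
  have hex : ∀ x, ∃ n, x ≤ e n := fun x => (he x).imp fun n h => h.ge
  let i : X → ℕ := fun x => Nat.find (hex x)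
  have hi : ∀ x, x ≤ e (i x) := fun x => Nat.find_spec (hex x)
  have himono : Monotone i := fun x y hxy => Nat.find_min' _ (hxy.trans (hi y))
  have hfit : ∀ n y, ∃ z, y < z ∧ EmbS {x | i x = n} (S ∩ Set.Ioo y z) := by
    intro n y
    obtain ⟨l, hl⟩ := decomp hs {x | i x = n}
    obtain ⟨y0, hy0⟩ := exists_gt (e n)
    refine gfit hm hS hl (y0 := y0) ?_ y
    rintro x rfl
    exact (hi x).trans_lt hy0
  choose Z hZ1 hZ2 using hfit
  let c : ℕ → X := fun n => Nat.rec (Classical.arbitrary X) (fun n p => Z n p) n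
  have hc : ∀ n, c (n+1) = Z n (c n) := fun n => rfl
  have hcm : Monotone c := monotone_nat_of_le_succ fun n => by rw [hc]; exact (hZ1 _ _).le
  have h := EmbS.glue (S := fun n => {x | i x = n}) (T := fun n => S ∩ Set.Ioo (c n) (c (n+1)))
    (fun n => hZ2 n (c n)) ?_
  · obtain ⟨g, hg1, hg2⟩ := h
    have hall : ∀ x, x ∈ ⋃ n, {x | i x = n} := fun x => Set.mem_iUnion.2 ⟨i x, rfl⟩
    refine embeds_iff.2 ⟨g, fun x y h => hg1 (hall x) (hall y) h, fun x => ?_⟩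
    obtain ⟨n, hn⟩ := Set.mem_iUnion.1 (hg2 (hall x))
    exact hn.1
  · rintro m n hmn x rfl y rfl hxy x' ⟨_, hx'⟩ y' ⟨_, hy'⟩
    have h1 : i x < i y := lt_of_le_of_ne (himono hxy.le) hmn
    exact hx'.2.trans_le ((hcm h1).trans hy'.1.le)

theorem mainlem [Countable X] [Nonempty X] (hu : Unt X) (hs : Scat X)
    (hT : ∀ x : X, Embeds X (Set.Ioi x)) (S : Set X) : Embeds X S ∨ Embeds X ↥(Sᶜ) := by
  have hm := noMax hT
  by_cases hN : Embeds X ℕ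
  · have key : ∀ T : Set X, T.Infinite → Embeds X T := by
      intro T hTi
      obtain ⟨f, hf⟩ := hN
      have : Infinite ↥(f '' T) := (hTi.image hf.injective.injOn).to_subtype
      classical
      have h1 : Embeds ℕ ↥(f '' T) :=
        embeds_iff.2 ⟨Nat.orderEmbeddingOfSet (f '' T), OrderEmbedding.strictMono _, fun n =>
          (Nat.orderEmbeddingOfSet_range (f '' T)).subset ⟨n, rfl⟩⟩
      refine Embeds.trans' ⟨f, hf⟩ (Embeds.trans' h1 ⟨fun p => ⟨p.2.choose, p.2.choose_spec.1⟩, ?_⟩)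
      intro p q hpq
      show p.2.choose < q.2.choose
      rw [← hf.lt_iff_lt, p.2.choose_spec.2, q.2.choose_spec.2]
      exact hpq
    by_cases hS : S.Infinite
    · exact Or.inl (key S hS)
    · exact Or.inr (key _ (Set.Finite.infinite_compl (Set.not_infinite.1 hS)))
  by_cases h1 : ∀ a, (∃ y : X, Emb a (Set.Iio y)) → ∀ y, ∃ z, Emb a (S ∩ Set.Ioo y z)
  · exact Or.inl (good_set hs hm h1)
  by_cases h2 : ∀ a, (∃ y : X, Emb a (Set.Iio y)) → ∀ y, ∃ z, Emb a (Sᶜ ∩ Set.Ioo y z)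
  · exact Or.inr (good_set hs hm h2)
  exfalso
  push Not at h1 h2
  obtain ⟨a, ⟨ya, hya⟩, y, hy⟩ := h1
  obtain ⟨b, hb, y', hy'⟩ := h2
  obtain ⟨g, hg, hgb⟩ := spaced hu hT hN hb
  have h3 := emb_subst hg hgb a (S := Set.Iio ya) (y := ya) (fun s hs => hs) hya
  obtain ⟨z, hz⟩ := bounded_far hT (a := subst a b) ⟨g ya, h3.mono (by
    rintro w ⟨s, _, _, h⟩; exact h)⟩ (max y y')
  rcases colour a b (S := S) hz with h | h
  · refine hy z (h.mono ?_)
    rintro w ⟨hw, hwS⟩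
    exact ⟨hwS, (le_max_left _ _).trans_lt hw.1, hw.2⟩
  · refine hy' z (h.mono ?_)
    rintro w ⟨hw, hwS⟩
    exact ⟨hwS, (le_max_right _ _).trans_lt hw.1, hw.2⟩
end
end Tm

/- The product `AB` (replace each point of `B` by a copy of `A`) is represented as
`B ×ₗ A`. -/
theorem stmt_17 (X : Type u) [LinearOrder X] [Countable X]
    (hu : ∀ (A B : Type u) [LinearOrder A] [LinearOrder B],
      Embeds A X → Embeds B X → Embeds X (B ×ₗ A) → Embeds X A ∨ Embeds X B)
    (h2 : ¬ Nonempty (X ≃ Fin 2)) :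
    ∀ S : Set X, Embeds X ↥S ∨ Embeds X ↥(Sᶜ) := by
  exact Tm.final hu h2 (fun Y _ _ _ a b c => Tm.mainlem a b c)
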